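/- arXiv:2112.10563 — 5 statements merged into one kernel-verified Lean document; each statement's English description precedes it below -/
import Mathlib

section
/- Let n ≥ 2 and p ≥ n. Let F : ℝ^{n×n} → [0,∞) be a continuous, isotropic, rank-one convex integrand which is positively p-homogeneous. Then for every A ∈ ℝ^{n×n} one has F(A) ≥ F(Id)·(max(det A, 0))^{p/n} and F(A) ≥ F(Īd)·(max(−det A, 0))^{p/n}, where Īd = diag(1,…,1,−1). In particular, since A ↦ (max(det A,0))^{p/n} is polyconvex and these lower bounds agree with F on CO⁺(n) and CO⁻(n) respectively, F is polyconvex at every conformal matrix. -/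
open Matrix MeasureTheory Set

/-- The operator norm `|A| = max_{|ξ|=1} |Aξ|` of a square matrix, computed via the
Euclidean spaces. -/
noncomputable def opNorm {n : ℕ} (A : Matrix (Fin n) (Fin n) ℝ) : ℝ :=
  ‖LinearMap.toContinuousLinearMap (Matrix.toEuclideanLin A)‖

/-- `F` is rank-one convex: `t ↦ F (A + t • X)` is convex whenever `rank X = 1`. -/
def RankOneConvex {n : ℕ} (F : Matrix (Fin n) (Fin n) ℝ → ℝ) : Prop :=
  ∀ A X : Matrix (Fin n) (Fin n) ℝ, X.rank = 1 →
    ConvexOn ℝ Set.univ (fun t : ℝ => F (A + t • X))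

/-- `F` is isotropic: `F (Q * A * R) = F A` for all `Q, R ∈ SO(n)`. -/
def Isotropic {n : ℕ} (F : Matrix (Fin n) (Fin n) ℝ → ℝ) : Prop :=
  ∀ (A Q R : Matrix (Fin n) (Fin n) ℝ),
    Qᵀ * Q = 1 → Q.det = 1 → Rᵀ * R = 1 → R.det = 1 → F (Q * A * R) = F A

/-- `F` is positively `p`-homogeneous: `F (t • A) = t ^ p * F A` for `t > 0`. -/
def PosHomogeneous {n : ℕ} (p : ℝ) (F : Matrix (Fin n) (Fin n) ℝ → ℝ) : Prop :=
  ∀ (A : Matrix (Fin n) (Fin n) ℝ) (t : ℝ), 0 < t → F (t • A) = t ^ p * F A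

/-- The set `CO(n) = {t • Q : Q ∈ O(n), t ∈ ℝ}` of conformal matrices. -/
def ConformalSet (n : ℕ) : Set (Matrix (Fin n) (Fin n) ℝ) :=
  {A | ∃ (t : ℝ) (Q : Matrix (Fin n) (Fin n) ℝ), Qᵀ * Q = 1 ∧ A = t • Q}

/-- The matrix `Īd = diag(1, …, 1, -1)`. -/
noncomputable def Ibar (n : ℕ) : Matrix (Fin n) (Fin n) ℝ :=
  Matrix.diagonal (fun i => if (i : ℕ) = n - 1 then -1 else 1)

/-- Every real positive definite matrix is diagonalised by a rotation. -/
lemma exists_rotation_diagonal_of_posDef {n : ℕ} (hn : 0 < n) {H : Matrix (Fin n) (Fin n) ℝ}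
    (hH : H.PosDef) : ∃ (V : Matrix (Fin n) (Fin n) ℝ) (μ : Fin n → ℝ),
      Vᵀ * V = 1 ∧ V.det = 1 ∧ (∀ i, 0 < μ i) ∧ Vᵀ * H * V = diagonal μ := by
  set W : Matrix (Fin n) (Fin n) ℝ := (hH.1.eigenvectorUnitary : Matrix (Fin n) (Fin n) ℝ) with hW
  have hWW : Wᵀ * W = 1 := by
    have := Unitary.coe_star_mul_self hH.1.eigenvectorUnitary
    rwa [star_eq_conjTranspose, conjTranspose_eq_transpose_of_trivial] at this
  have hspec : Wᵀ * H * W = diagonal hH.1.eigenvalues := by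
    have h := hH.1.spectral_theorem
    rw [Unitary.conjStarAlgAut_apply, star_eq_conjTranspose,
      conjTranspose_eq_transpose_of_trivial, ← hW] at h
    calc Wᵀ * H * W = (Wᵀ * W) * Matrix.diagonal (RCLike.ofReal ∘ hH.1.eigenvalues) * (Wᵀ * W) := by
          conv_lhs => rw [h]
          simp only [Matrix.mul_assoc]
      _ = diagonal hH.1.eigenvalues := by
          rw [hWW, one_mul, mul_one]
          rfl
  have hdet : W.det = 1 ∨ W.det = -1 := by
    have h := congrArg Matrix.det hWW
    rw [det_mul, det_transpose, det_one] at h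
    exact mul_self_eq_one_iff.mp h
  rcases hdet with hdet | hdet
  · exact ⟨W, _, hWW, hdet, hH.eigenvalues_pos, hspec⟩
  · set e : Fin n → ℝ := Function.update 1 ⟨0, hn⟩ (-1) with he
    have hee : ∀ i, e i * e i = 1 := by
      intro i
      by_cases h : i = ⟨0, hn⟩
      · subst h
        simp [he]
      · simp [he, h]
    refine ⟨W * diagonal e, hH.1.eigenvalues, ?_, ?_, hH.eigenvalues_pos, ?_⟩
    · calc (W * diagonal e)ᵀ * (W * diagonal e) = diagonal e * (Wᵀ * W) * diagonal e := by
            rw [transpose_mul, diagonal_transpose]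
            noncomm_ring
        _ = 1 := by
            rw [hWW, mul_one, diagonal_mul_diagonal]
            simp [hee]
    · rw [det_mul, hdet, det_diagonal, he, Finset.prod_update_of_mem (Finset.mem_univ _)]
      simp
    · calc (W * diagonal e)ᵀ * H * (W * diagonal e)
          = diagonal e * (Wᵀ * H * W) * diagonal e := by
            rw [transpose_mul, diagonal_transpose]
            noncomm_ring
        _ = diagonal hH.1.eigenvalues := by
            rw [hspec, diagonal_mul_diagonal, diagonal_mul_diagonal]
            congr 1
            ext i
            linear_combination hH.1.eigenvalues i * hee i

/-- Singular value decomposition with rotations, for matrices of positive determinant. -/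
lemma exists_rotation_mul_diagonal_mul_rotation {n : ℕ} (hn : 0 < n)
    {A : Matrix (Fin n) (Fin n) ℝ} (hA : 0 < A.det) :
    ∃ (Q R : Matrix (Fin n) (Fin n) ℝ) (σ : Fin n → ℝ),
      Qᵀ * Q = 1 ∧ Q.det = 1 ∧ Rᵀ * R = 1 ∧ R.det = 1 ∧ (∀ i, 0 < σ i) ∧
        A = Q * diagonal σ * R := by
  have hinj : Function.Injective A.mulVec :=
    mulVec_injective_iff_isUnit.mpr ((isUnit_iff_isUnit_det A).mpr hA.ne'.isUnit)
  obtain ⟨V, μ, hV, hVdet, hμ, hVH⟩ := exists_rotation_diagonal_of_posDef hn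
    (PosDef.conjTranspose_mul_self A hinj)
  rw [conjTranspose_eq_transpose_of_trivial] at hVH
  have hV' : V * Vᵀ = 1 := mul_eq_one_comm.mp hV
  set σ : Fin n → ℝ := fun i => √(μ i) with hσ
  have hσpos : ∀ i, 0 < σ i := fun i => Real.sqrt_pos.mpr (hμ i)
  have hσsq : ∀ i, σ i * σ i = μ i := fun i => Real.mul_self_sqrt (hμ i).le
  have hinv : diagonal (fun i => (σ i)⁻¹) * diagonal σ = 1 := by
    rw [diagonal_mul_diagonal, ← diagonal_one]
    congr 1
    ext i
    exact inv_mul_cancel₀ (hσpos i).ne'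
  have hfac : A = A * V * diagonal (fun i => (σ i)⁻¹) * diagonal σ * Vᵀ := by
    calc A = A * (V * 1 * Vᵀ) := by rw [mul_one, hV', mul_one]
      _ = _ := by rw [← hinv]; noncomm_ring
  have hQ : (A * V * diagonal (fun i => (σ i)⁻¹))ᵀ * (A * V * diagonal (fun i => (σ i)⁻¹)) = 1 := by
    calc (A * V * diagonal (fun i => (σ i)⁻¹))ᵀ * (A * V * diagonal (fun i => (σ i)⁻¹))
        = diagonal (fun i => (σ i)⁻¹) * (Vᵀ * (Aᵀ * A) * V) * diagonal (fun i => (σ i)⁻¹) := by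
          rw [transpose_mul, transpose_mul, diagonal_transpose]
          noncomm_ring
      _ = 1 := by
          rw [hVH, diagonal_mul_diagonal, diagonal_mul_diagonal, ← diagonal_one]
          congr 1
          ext i
          rw [← hσsq i]
          have := (hσpos i).ne'
          field_simp
  refine ⟨_, Vᵀ, σ, hQ, ?_, by rw [transpose_transpose, hV'], by rw [det_transpose, hVdet],
    hσpos, hfac⟩
  have h := congrArg Matrix.det hQ
  rw [det_mul, det_transpose, det_one] at h
  refine (mul_self_eq_one_iff.mp h).resolve_right fun hneg => ?_
  have hpos : 0 < (A * V * diagonal (fun i => (σ i)⁻¹)).det := by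
    rw [det_mul, det_mul, hVdet, mul_one, det_diagonal]
    exact mul_pos hA (Finset.prod_pos fun i _ => inv_pos.mpr (hσpos i))
  linarith

/-- The inclusion of the coordinate plane spanned by `e i` and `e j`. -/
def planeIncl {n : ℕ} (i j : Fin n) : Matrix (Fin n) (Fin 2) ℝ :=
  (1 : Matrix (Fin n) (Fin n) ℝ).submatrix id ![i, j]

/-- The matrix acting as `B` on the coordinate plane `(i, j)` and as `diagonal d` on the remaining
coordinates. -/
def planeBlock {n : ℕ} (i j : Fin n) (d : Fin n → ℝ) (B : Matrix (Fin 2) (Fin 2) ℝ) :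
    Matrix (Fin n) (Fin n) ℝ :=
  diagonal (Function.update (Function.update d i 0) j 0) + planeIncl i j * B * (planeIncl i j)ᵀ

section PlaneBlock

variable {n : ℕ} {i j : Fin n}

lemma planeIncl_transpose_mul_self (hij : i ≠ j) : (planeIncl i j)ᵀ * planeIncl i j = 1 := by
  rw [planeIncl, transpose_submatrix, ← submatrix_mul _ _ _ _ _ Function.bijective_id,
    transpose_one, one_mul]
  refine submatrix_one _ fun k l h => ?_
  fin_cases k <;> fin_cases l <;> simp_all

lemma diagonal_update_mul_planeIncl (d : Fin n → ℝ) :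
    diagonal (Function.update (Function.update d i 0) j 0) * planeIncl i j = 0 := by
  ext k l
  rw [diagonal_mul, Matrix.zero_apply, mul_eq_zero, planeIncl, submatrix_apply, id]
  by_cases hj : k = j
  · simp [hj]
  · by_cases hi : k = i
    · subst hi
      simp [hj]
    · right
      fin_cases l <;> simp [one_apply, hi, hj]

lemma planeIncl_transpose_mul_diagonal_update (d : Fin n → ℝ) :
    (planeIncl i j)ᵀ * diagonal (Function.update (Function.update d i 0) j 0) = 0 := by
  have h := congrArg transpose (diagonal_update_mul_planeIncl (i := i) (j := j) d)
  rwa [transpose_mul, diagonal_transpose, transpose_zero] at h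

lemma planeBlock_mul (hij : i ≠ j) (d e : Fin n → ℝ) (B C : Matrix (Fin 2) (Fin 2) ℝ) :
    planeBlock i j d B * planeBlock i j e C = planeBlock i j (d * e) (B * C) := by
  have h1 : diagonal (Function.update (Function.update d i 0) j 0) *
      (planeIncl i j * C * (planeIncl i j)ᵀ) = 0 := by
    rw [← Matrix.mul_assoc, ← Matrix.mul_assoc, diagonal_update_mul_planeIncl, Matrix.zero_mul,
      Matrix.zero_mul]
  have h2 : planeIncl i j * B * (planeIncl i j)ᵀ *
      diagonal (Function.update (Function.update e i 0) j 0) = 0 := by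
    rw [Matrix.mul_assoc, planeIncl_transpose_mul_diagonal_update, Matrix.mul_zero]
  have h3 : planeIncl i j * B * (planeIncl i j)ᵀ * (planeIncl i j * C * (planeIncl i j)ᵀ) =
      planeIncl i j * (B * C) * (planeIncl i j)ᵀ := by
    calc _ = planeIncl i j * B * ((planeIncl i j)ᵀ * planeIncl i j) * C * (planeIncl i j)ᵀ := by
          simp only [Matrix.mul_assoc]
      _ = _ := by
          rw [planeIncl_transpose_mul_self hij]
          simp only [Matrix.mul_assoc, Matrix.one_mul]
  have h4 : diagonal (Function.update (Function.update d i 0) j 0) *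
      diagonal (Function.update (Function.update e i 0) j 0) =
      diagonal (Function.update (Function.update (d * e) i 0) j 0) := by
    rw [diagonal_mul_diagonal]
    congr 1
    ext k
    simp only [Function.update_apply, Pi.mul_apply]
    split_ifs <;> simp
  rw [planeBlock, planeBlock, planeBlock, Matrix.add_mul, Matrix.mul_add, Matrix.mul_add,
    h1, h2, h3, h4, add_zero, zero_add]

lemma planeBlock_transpose (d : Fin n → ℝ) (B : Matrix (Fin 2) (Fin 2) ℝ) :
    (planeBlock i j d B)ᵀ = planeBlock i j d Bᵀ := by
  simp [planeBlock, transpose_mul, Matrix.mul_assoc]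

lemma planeBlock_upper_triangular (hij : i ≠ j) (d : Fin n → ℝ) (x y t : ℝ) :
    planeBlock i j d !![x, t; 0, y] =
      diagonal (Function.update (Function.update d i x) j y) + t • single i j (1 : ℝ) := by
  ext k l
  simp only [planeBlock, planeIncl, Matrix.add_apply, Matrix.smul_apply, Matrix.mul_apply,
    Fin.sum_univ_two, transpose_apply, submatrix_apply, one_apply, diagonal_apply, Function.update_apply,
    single_apply]
  by_cases hki : k = i
  · subst hki
    by_cases hlk : l = k
    · subst hlk; simp [hij, hij.symm]
    · by_cases hlj : l = j
      · subst hlj; simp [hij, hlk]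
      · simp [hij, Ne.symm hlk, Ne.symm hlj, hlk, hlj]
  · by_cases hkj : k = j
    · subst hkj
      by_cases hlk : l = k
      · subst hlk; simp [hki, hij]
      · simp [hki, hlk, Ne.symm hlk, Ne.symm hki]
    · simp [hki, hkj, Ne.symm hki]

lemma planeBlock_one_one (hij : i ≠ j) : planeBlock i j 1 1 = 1 := by
  have h := planeBlock_upper_triangular hij 1 1 1 0
  rw [← one_fin_two] at h
  rw [h, zero_smul, add_zero, ← diagonal_one]
  congr 1
  ext k
  simp [Function.update_apply]

lemma planeBlock_one_det (hij : i ≠ j) (B : Matrix (Fin 2) (Fin 2) ℝ) :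
    (planeBlock i j 1 B).det = B.det := by
  have h : planeBlock i j 1 B = 1 + planeIncl i j * ((B - 1) * (planeIncl i j)ᵀ) := by
    conv_rhs => rw [← planeBlock_one_one hij]
    rw [planeBlock, planeBlock, Matrix.sub_mul, Matrix.mul_sub, Matrix.mul_assoc, Matrix.mul_assoc]
    abel
  rw [h, det_one_add_mul_comm, Matrix.mul_assoc, planeIncl_transpose_mul_self hij, Matrix.mul_one,
    add_sub_cancel]

/-- Rotating in the `(i, j)` plane turns `diag(x, y)` into an upper triangular block with prescribed
first diagonal entry `g` between `x` and `y`; the off-diagonal entry can be taken with either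
sign. -/
lemma Isotropic.planeBlock_eq {F : Matrix (Fin n) (Fin n) ℝ → ℝ} (hiso : Isotropic F)
    (hij : i ≠ j) (d : Fin n → ℝ) {x y g c s : ℝ} (hg : g ≠ 0) (hcs : c ^ 2 + s ^ 2 = 1)
    (hxy : x ^ 2 * c ^ 2 + y ^ 2 * s ^ 2 = g ^ 2) :
    F (planeBlock i j d !![g, c * s * (y ^ 2 - x ^ 2) / g; 0, x * y / g]) =
      F (planeBlock i j d !![x, 0; 0, y]) := by
  set Q : Matrix (Fin 2) (Fin 2) ℝ := !![x * c / g, y * s / g; -(y * s / g), x * c / g] with hQ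
  set R : Matrix (Fin 2) (Fin 2) ℝ := !![c, -s; s, c] with hR
  have hQQ : Qᵀ * Q = 1 := by
    rw [hQ, one_fin_two]
    ext k l
    fin_cases k <;> fin_cases l <;> simp [Matrix.mul_apply, Fin.sum_univ_two] <;> field_simp <;>
      first | linear_combination hxy | ring
  have hRR : Rᵀ * R = 1 := by
    rw [hR, one_fin_two]
    ext k l
    fin_cases k <;> fin_cases l <;> simp [Matrix.mul_apply, Fin.sum_univ_two] <;>
      first | linear_combination hcs | ring
  have hQd : Q.det = 1 := by
    rw [hQ, det_fin_two_of]
    field_simp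
    linear_combination hxy
  have hRd : R.det = 1 := by
    rw [hR, det_fin_two_of]
    linear_combination hcs
  have hprod : Q * !![x, 0; 0, y] * R = !![g, c * s * (y ^ 2 - x ^ 2) / g; 0, x * y / g] := by
    rw [hQ, hR]
    ext k l
    fin_cases k <;> fin_cases l <;> simp [Matrix.mul_apply, Fin.sum_univ_two] <;> field_simp <;>
      first | linear_combination hxy | linear_combination x * y * hcs | ring
  have h := hiso (planeBlock i j d !![x, 0; 0, y]) (planeBlock i j 1 Q) (planeBlock i j 1 R)
    (by rw [planeBlock_transpose, planeBlock_mul hij, hQQ, one_mul, planeBlock_one_one hij])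
    (by rw [planeBlock_one_det hij, hQd])
    (by rw [planeBlock_transpose, planeBlock_mul hij, hRR, one_mul, planeBlock_one_one hij])
    (by rw [planeBlock_one_det hij, hRd])
  rwa [planeBlock_mul hij, planeBlock_mul hij, one_mul, mul_one, hprod] at h

end PlaneBlock

lemma rank_single_one {n : ℕ} (i j : Fin n) : (single i j (1 : ℝ)).rank = 1 := by
  refine le_antisymm ?_ ?_
  · rw [single_eq_single_vecMulVec_single]
    exact rank_vecMulVec_le _ _
  · rw [Nat.one_le_iff_ne_zero, Ne, Matrix.rank, Submodule.finrank_eq_zero,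
      LinearMap.range_eq_bot]
    intro h
    simpa using congrFun (LinearMap.congr_fun h (Pi.single j 1)) i

/-- Moving two singular values `x < y` to `g ∈ [x, y]` and `x * y / g` does not increase `F`. -/
lemma diagonal_update_le {n : ℕ} {F : Matrix (Fin n) (Fin n) ℝ → ℝ} (hiso : Isotropic F)
    (hrc : RankOneConvex F) (d : Fin n → ℝ) {i j : Fin n} {g : ℝ} (hi : 0 < d i)
    (hig : d i < g) (hgj : g < d j) :
    F (diagonal (Function.update (Function.update d i g) j (d i * d j / g))) ≤ F (diagonal d) := by
  have hg : 0 < g := hi.trans hig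
  have hij : i ≠ j := by
    rintro rfl
    exact lt_asymm hig hgj
  have hden : 0 < d j ^ 2 - d i ^ 2 := by nlinarith
  set c := √((d j ^ 2 - g ^ 2) / (d j ^ 2 - d i ^ 2)) with hc
  set s := √((g ^ 2 - d i ^ 2) / (d j ^ 2 - d i ^ 2)) with hs
  have hc2 : c ^ 2 = (d j ^ 2 - g ^ 2) / (d j ^ 2 - d i ^ 2) :=
    Real.sq_sqrt (div_nonneg (by nlinarith) hden.le)
  have hs2 : s ^ 2 = (g ^ 2 - d i ^ 2) / (d j ^ 2 - d i ^ 2) :=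
    Real.sq_sqrt (div_nonneg (by nlinarith) hden.le)
  have hcs : c ^ 2 + s ^ 2 = 1 := by
    rw [hc2, hs2]
    field_simp
    ring
  have hxy : d i ^ 2 * c ^ 2 + d j ^ 2 * s ^ 2 = g ^ 2 := by
    rw [hc2, hs2]
    field_simp
    ring
  have hd : planeBlock i j d !![d i, 0; 0, d j] = diagonal d := by
    rw [planeBlock_upper_triangular hij]
    simp
  have hplus := hiso.planeBlock_eq hij d hg.ne' hcs hxy
  have hminus := hiso.planeBlock_eq (x := d i) (y := d j) (c := c) (s := -s) hij d hg.ne' (by rwa [neg_sq]) (by rwa [neg_sq])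
  rw [planeBlock_upper_triangular hij, hd] at hplus hminus
  have hconv := (hrc (diagonal (Function.update (Function.update d i g) j (d i * d j / g)))
    (single i j 1) (rank_single_one i j)).2 (mem_univ (c * s * (d j ^ 2 - d i ^ 2) / g))
    (mem_univ (c * -s * (d j ^ 2 - d i ^ 2) / g)) (by norm_num : (0 : ℝ) ≤ 1 / 2)
    (by norm_num : (0 : ℝ) ≤ 1 / 2) (by norm_num)
  have hmid : (1 / 2 : ℝ) • (c * s * (d j ^ 2 - d i ^ 2) / g) +
      (1 / 2 : ℝ) • (c * -s * (d j ^ 2 - d i ^ 2) / g) = 0 := by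
    simp only [smul_eq_mul]
    ring
  beta_reduce at hconv
  rw [hmid, hplus, hminus, zero_smul, add_zero, smul_eq_mul] at hconv
  linarith

/-- Among positive diagonal matrices of given determinant, `F` is smallest at the multiple of the
identity. -/
lemma smul_one_le_diagonal {n : ℕ} {F : Matrix (Fin n) (Fin n) ℝ → ℝ} (hiso : Isotropic F)
    (hrc : RankOneConvex F) {g : ℝ} (hg : 0 < g) (d : Fin n → ℝ) (hd : ∀ i, 0 < d i)
    (hprod : ∏ i, d i = g ^ n) : F (g • 1) ≤ F (diagonal d) := by
  induction hk : (Finset.univ.filter fun i => d i ≠ g).card using Nat.strong_induction_on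
    generalizing d with
  | _ k ih =>
  by_cases hall : ∀ i, d i = g
  · rw [funext hall, smul_one_eq_diagonal]
  have hconst : ∏ _i : Fin n, g = g ^ n := by simp
  push Not at hall
  obtain ⟨m, hm⟩ := hall
  obtain ⟨i, hi⟩ : ∃ i, d i < g := by
    by_contra! h
    have := Finset.prod_lt_prod (s := Finset.univ) (f := fun _ => g) (g := d) (fun _ _ => hg)
      (fun i _ => h i) ⟨m, Finset.mem_univ _, lt_of_le_of_ne (h m) hm.symm⟩
    linarith
  obtain ⟨j, hj⟩ : ∃ j, g < d j := by
    by_contra! h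
    have := Finset.prod_lt_prod (s := Finset.univ) (f := d) (g := fun _ => g) (fun i _ => hd i)
      (fun i _ => h i) ⟨m, Finset.mem_univ _, lt_of_le_of_ne (h m) hm⟩
    linarith
  have hij : i ≠ j := by
    rintro rfl
    exact lt_asymm hi hj
  refine le_trans (ih _ ?_ _ ?_ ?_ rfl) (diagonal_update_le hiso hrc d (hd i) hi hj)
  · rw [← hk]
    refine Finset.card_lt_card (Finset.ssubset_iff_of_subset ?_ |>.mpr ⟨i, ?_, ?_⟩)
    · intro l
      simp only [Finset.mem_filter, Finset.mem_univ, true_and, Function.update_apply]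
      split_ifs with h1 h2
      · exact fun _ => h1 ▸ hj.ne'
      · exact fun h => absurd rfl h
      · exact id
    · simpa using hi.ne
    · simp [hij]
  · intro l
    simp only [Function.update_apply]
    split_ifs
    · exact div_pos (mul_pos (hd i) (hd j)) hg
    · exact hg
    · exact hd l
  · rw [← hprod, ← Finset.mul_prod_erase _ _ (Finset.mem_univ j),
      ← Finset.mul_prod_erase _ _ (Finset.mem_erase.mpr ⟨hij, Finset.mem_univ i⟩),
      ← Finset.mul_prod_erase _ d (Finset.mem_univ j),
      ← Finset.mul_prod_erase _ d (Finset.mem_erase.mpr ⟨hij, Finset.mem_univ i⟩)]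
    have : ∏ l ∈ (Finset.univ.erase j).erase i,
        Function.update (Function.update d i g) j (d i * d j / g) l =
        ∏ l ∈ (Finset.univ.erase j).erase i, d l := by
      refine Finset.prod_congr rfl fun l hl => ?_
      simp only [Finset.mem_erase] at hl
      simp [hl.1, hl.2.1]
    rw [this]
    simp only [Function.update_self, Function.update_of_ne hij]
    field_simp

lemma mul_max_det_rpow_le {n : ℕ} (hn : 0 < n) {p : ℝ} (hp : 0 < p)
    {F : Matrix (Fin n) (Fin n) ℝ → ℝ} (hF0 : ∀ A, 0 ≤ F A)
    (hiso : Isotropic F) (hrc : RankOneConvex F) (hhom : PosHomogeneous p F)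
    (A : Matrix (Fin n) (Fin n) ℝ) : F 1 * max A.det 0 ^ (p / (n : ℝ)) ≤ F A := by
  have hn' : (0 : ℝ) < n := by exact_mod_cast hn
  rcases le_or_gt A.det 0 with hdet | hdet
  · rw [max_eq_right hdet, Real.zero_rpow (div_pos hp hn').ne', mul_zero]
    exact hF0 A
  rw [max_eq_left hdet.le]
  obtain ⟨Q, R, σ, hQ, hQd, hR, hRd, hσ, hA⟩ := exists_rotation_mul_diagonal_mul_rotation hn hdet
  have hprod : ∏ i, σ i = A.det := by
    rw [hA, det_mul, det_mul, hQd, hRd, det_diagonal, one_mul, mul_one]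
  have hg : 0 < A.det ^ (1 / (n : ℝ)) := Real.rpow_pos_of_pos hdet _
  have hgn : (A.det ^ (1 / (n : ℝ))) ^ n = A.det := by
    rw [← Real.rpow_natCast, ← Real.rpow_mul hdet.le, one_div_mul_cancel hn'.ne', Real.rpow_one]
  have hle := smul_one_le_diagonal hiso hrc hg σ hσ (hprod.trans hgn.symm)
  rw [hhom 1 _ hg, ← Real.rpow_mul hdet.le, one_div_mul_eq_div] at hle
  calc F 1 * A.det ^ (p / (n : ℝ)) ≤ F (diagonal σ) := by rwa [mul_comm]
    _ = F A := by rw [hA, hiso _ Q R hQ hQd hR hRd]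

lemma Ibar_transpose (n : ℕ) : (Ibar n)ᵀ = Ibar n := diagonal_transpose _

lemma Ibar_mul_self (n : ℕ) : Ibar n * Ibar n = 1 := by
  rw [Ibar, diagonal_mul_diagonal, ← diagonal_one]
  congr 1
  ext i
  split_ifs <;> norm_num

lemma Ibar_det {n : ℕ} (hn : 0 < n) : (Ibar n).det = -1 := by
  rw [Ibar, det_diagonal, Finset.prod_eq_single (⟨n - 1, by omega⟩ : Fin n)]
  · simp
  · intro i _ hi
    rw [if_neg fun h => hi (Fin.ext h)]
  · simp

lemma Isotropic.comp_mul_Ibar {n : ℕ} {F : Matrix (Fin n) (Fin n) ℝ → ℝ} (hn : 0 < n)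
    (hiso : Isotropic F) : Isotropic fun B => F (B * Ibar n) := by
  intro A Q R hQ hQd hR hRd
  have h := hiso (A * Ibar n) Q (Ibar n * R * Ibar n) hQ hQd ?_ ?_
  · refine Eq.trans (congrArg F ?_) h
    calc Q * A * R * Ibar n = Q * A * 1 * R * Ibar n := by rw [mul_one]
      _ = _ := by
        rw [← Ibar_mul_self]
        noncomm_ring
  · calc (Ibar n * R * Ibar n)ᵀ * (Ibar n * R * Ibar n)
        = Ibar n * Rᵀ * (Ibar n * Ibar n) * R * Ibar n := by
          simp only [transpose_mul, Ibar_transpose]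
          noncomm_ring
      _ = Ibar n * (Rᵀ * R) * Ibar n := by
          rw [Ibar_mul_self]
          noncomm_ring
      _ = 1 := by rw [hR, mul_one, Ibar_mul_self]
  · simp [det_mul, Ibar_det hn, hRd]

lemma RankOneConvex.comp_mul_Ibar {n : ℕ} {F : Matrix (Fin n) (Fin n) ℝ → ℝ} (hn : 0 < n)
    (hrc : RankOneConvex F) : RankOneConvex fun B => F (B * Ibar n) := by
  intro A X hX
  have hunit : IsUnit (Ibar n).det := by rw [Ibar_det hn]; exact isUnit_one.neg
  simpa only [Matrix.add_mul, Matrix.smul_mul] using hrc (A * Ibar n) (X * Ibar n)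
    (by rw [rank_mul_eq_left_of_isUnit_det _ _ hunit, hX])

lemma PosHomogeneous.comp_mul_Ibar {n : ℕ} {p : ℝ} {F : Matrix (Fin n) (Fin n) ℝ → ℝ}
    (hhom : PosHomogeneous p F) : PosHomogeneous p fun B => F (B * Ibar n) := by
  intro A t ht
  simpa only [Matrix.smul_mul] using hhom (A * Ibar n) t ht


/-- If `n ≥ 2`, `p ≥ n` and `F : ℝ^{n×n} → [0,∞)` is continuous,
isotropic, rank-one convex and positively `p`-homogeneous, then for every `A`,
`F(A) ≥ F(Id)·(max(det A, 0))^(p/n)` and `F(A) ≥ F(Īd)·(max(-det A, 0))^(p/n)`. -/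
theorem stmt_0 {n : ℕ} (hn : 2 ≤ n) (p : ℝ) (hp : (n : ℝ) ≤ p)
    (F : Matrix (Fin n) (Fin n) ℝ → ℝ) (hFc : Continuous F) (hF0 : ∀ A, 0 ≤ F A)
    (hiso : Isotropic F) (hrc : RankOneConvex F) (hhom : PosHomogeneous p F)
    (A : Matrix (Fin n) (Fin n) ℝ) :
    F 1 * max A.det 0 ^ (p / (n : ℝ)) ≤ F A ∧
    F (Ibar n) * max (-A.det) 0 ^ (p / (n : ℝ)) ≤ F A := by
  have hn0 : 0 < n := by omega
  have hp0 : 0 < p := lt_of_lt_of_le (by exact_mod_cast hn0) hp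
  refine ⟨mul_max_det_rpow_le hn0 hp0 hF0 hiso hrc hhom A, ?_⟩
  have h := mul_max_det_rpow_le hn0 hp0 (fun B => hF0 (B * Ibar n)) (hiso.comp_mul_Ibar hn0)
    (hrc.comp_mul_Ibar hn0) hhom.comp_mul_Ibar (A * Ibar n)
  simpa only [one_mul, Matrix.mul_assoc, Ibar_mul_self, mul_one, det_mul, Ibar_det hn0,
    mul_neg] using h
end

section
/- Let p ≥ 2 and let F : ℝ^{2×2} → [0,∞) be a continuous, isotropic, rank-one convex integrand which is positively p-homogeneous. Then F is quasiconvex at every A ∈ CO(2): for every bounded open set Ω ⊂ ℝ² and every Lipschitz map φ : ℝ² → ℝ² vanishing outside Ω, F(A)·|Ω| ≤ ∫_Ω F(A + Dφ(x)) dx, where Dφ denotes the a.e. derivative of φ and |Ω| the Lebesgue measure of Ω. -/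
open Matrix MeasureTheory Set

/-- The matrix of the a.e. derivative of `φ` at `x`: entries `(Dφ)_{ij} = ∂_j φ_i` (junk
value where `φ` is not differentiable). -/
noncomputable def gradMat {n : ℕ} (φ : (Fin n → ℝ) → (Fin n → ℝ)) (x : Fin n → ℝ) :
    Matrix (Fin n) (Fin n) ℝ :=
  Matrix.of fun i j => fderiv ℝ φ x (Pi.single j 1) i

/-- `F` is quasiconvex at `A`: for every bounded open `Ω ⊂ ℝ²` and every Lipschitz
`φ : ℝ² → ℝ²` vanishing outside `Ω` one has `F(A)·|Ω| ≤ ∫_Ω F(A + Dφ)`. -/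
def QuasiconvexAt (F : Matrix (Fin 2) (Fin 2) ℝ → ℝ) (A : Matrix (Fin 2) (Fin 2) ℝ) : Prop :=
  ∀ (Ω : Set (Fin 2 → ℝ)), IsOpen Ω → Bornology.IsBounded Ω →
    ∀ (φ : (Fin 2 → ℝ) → (Fin 2 → ℝ)) (K : NNReal), LipschitzWith K φ →
      (∀ x ∉ Ω, φ x = 0) →
      F A * (volume Ω).toReal ≤ ∫ x in Ω, F (A + gradMat φ x)

section Algebra

variable {F : Matrix (Fin 2) (Fin 2) ℝ → ℝ}

theorem Isotropic.apply_rotation_mul_mul_rotation (hiso : Isotropic F)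
    (A : Matrix (Fin 2) (Fin 2) ℝ) {x y x' y' : ℝ}
    (h : x ^ 2 + y ^ 2 = 1) (h' : x' ^ 2 + y' ^ 2 = 1) :
    F (!![x, -y; y, x] * A * !![x', -y'; y', x']) = F A := by
  refine hiso _ _ _ ?_ ?_ ?_ ?_
  · ext i j
    fin_cases i <;> fin_cases j <;> simp [Matrix.mul_apply, Fin.sum_univ_two] <;> linarith
  · rw [Matrix.det_fin_two_of]; linarith
  · ext i j
    fin_cases i <;> fin_cases j <;> simp [Matrix.mul_apply, Fin.sum_univ_two] <;> linarith
  · rw [Matrix.det_fin_two_of]; linarith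

theorem Isotropic.apply_one_le_apply_shear (hiso : Isotropic F) (hrc : RankOneConvex F)
    {w z r : ℝ} (h : w ^ 2 + z ^ 2 = r ^ 2) :
    F 1 ≤ F !![1 + w, z - r; z + r, 1 - w] := by
  rcases eq_or_ne r 0 with rfl | hr
  · have hw : w = 0 := by nlinarith [sq_nonneg w, sq_nonneg z]
    have hz : z = 0 := by nlinarith [sq_nonneg w, sq_nonneg z]
    subst hw hz
    simp [← Matrix.one_fin_two]
  set X : Matrix (Fin 2) (Fin 2) ℝ := !![w, z - r; z + r, -w] with hX
  have hrank : X.rank = 1 := by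
    have hdet : X.det = 0 := by rw [hX, Matrix.det_fin_two_of]; linarith
    have hne : X ≠ 0 := by
      intro h0
      have h1 := congrFun₂ h0 0 1
      have h2 := congrFun₂ h0 1 0
      simp [hX] at h1 h2
      exact hr (by linarith)
    have hpos : X.rank ≠ 0 := by
      intro h0
      apply hne
      rw [Matrix.rank, Submodule.finrank_eq_zero, LinearMap.range_eq_bot] at h0
      exact Matrix.ext_of_mulVec_single fun i => by
        rw [Matrix.zero_mulVec]
        exact LinearMap.congr_fun h0 _
    obtain ⟨v, hv, hXv⟩ := Matrix.exists_mulVec_eq_zero_iff.2 hdet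
    have hker : Module.finrank ℝ (LinearMap.ker X.mulVecLin) ≠ 0 := by
      rw [Ne, Submodule.finrank_eq_zero]
      exact fun h0 => hv (LinearMap.ker_eq_bot'.1 h0 v hXv)
    have hsum := X.mulVecLin.finrank_range_add_finrank_ker
    rw [Module.finrank_fin_fun] at hsum
    rw [Matrix.rank] at hpos ⊢
    omega
  have hplus : (1 + (1 : ℝ) • X) = !![1 + w, z - r; z + r, 1 - w] := by
    ext i j
    fin_cases i <;> fin_cases j <;> simp [hX]
    ring
  have hsymm : F (1 + (-1 : ℝ) • X) = F !![1 + w, z - r; z + r, 1 - w] := by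
    obtain ⟨b, hb⟩ : ∃ b : ℝ, b ^ 2 * (1 + r ^ 2) = 1 :=
      ⟨(√(1 + r ^ 2))⁻¹, by
        rw [inv_pow, Real.sq_sqrt (by positivity)]
        exact inv_mul_cancel₀ (by positivity)⟩
    have hminus : 1 + (-1 : ℝ) • X = !![1 - w, r - z; -r - z, 1 + w] := by
      ext i j
      fin_cases i <;> fin_cases j <;> simp [hX] <;> ring
    rw [hminus, ← hiso.apply_rotation_mul_mul_rotation _
      (by linear_combination hb : (-(r * b)) ^ 2 + b ^ 2 = 1)
      (by linear_combination hb : (r * b) ^ 2 + (-b) ^ 2 = 1)]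
    congr 1
    ext i j
    fin_cases i <;> fin_cases j <;> simp [Matrix.mul_apply, Fin.sum_univ_two]
    · linear_combination (1 + w) * hb
    · linear_combination (z - r) * hb
    · linear_combination (z + r) * hb
    · linear_combination (1 - w) * hb
  have hconv := (hrc 1 X hrank).2 (mem_univ (1 : ℝ)) (mem_univ (-1 : ℝ))
    (by norm_num : (0 : ℝ) ≤ 1 / 2) (by norm_num : (0 : ℝ) ≤ 1 / 2) (by norm_num)
  simp only [hplus, hsymm, smul_eq_mul] at hconv
  norm_num at hconv
  linarith

/-- Every matrix of determinant one is, up to a rotation, one end of a rank-one segment centred at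
the identity along which `F` is even. -/
theorem Isotropic.apply_one_le_of_det_eq_one (hiso : Isotropic F) (hrc : RankOneConvex F)
    {A : Matrix (Fin 2) (Fin 2) ℝ} (hA : A.det = 1) : F 1 ≤ F A := by
  obtain ⟨u, v, w, z, hA'⟩ : ∃ u v w z : ℝ, A = !![u + w, z - v; z + v, u - w] :=
    ⟨(A 0 0 + A 1 1) / 2, (A 1 0 - A 0 1) / 2, (A 0 0 - A 1 1) / 2, (A 0 1 + A 1 0) / 2, by
      ext i j; fin_cases i <;> fin_cases j <;> simp <;> ring⟩
  subst hA'
  rw [Matrix.det_fin_two_of] at hA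
  obtain ⟨r, hr⟩ : ∃ r : ℝ, w ^ 2 + z ^ 2 = r ^ 2 :=
    ⟨√(w ^ 2 + z ^ 2), (Real.sq_sqrt (by positivity)).symm⟩
  have hpos : 0 < 1 + r ^ 2 := by positivity
  have huv : u ^ 2 + v ^ 2 = 1 + r ^ 2 := by linarith
  obtain ⟨x, hx⟩ : ∃ x, x = (u + r * v) / (1 + r ^ 2) := ⟨_, rfl⟩
  obtain ⟨y, hy⟩ : ∃ y, y = (r * u - v) / (1 + r ^ 2) := ⟨_, rfl⟩
  have hxy : x ^ 2 + y ^ 2 = 1 := by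
    rw [hx, hy]; field_simp
    linear_combination (1 + r ^ 2) * huv
  have hre : x * u - y * v = 1 := by rw [hx, hy]; field_simp; linarith
  have him : x * v + y * u = r := by rw [hx, hy]; field_simp; linear_combination r * huv
  have hwz : (x * w - y * z) ^ 2 + (y * w + x * z) ^ 2 = r ^ 2 := by
    linear_combination (w ^ 2 + z ^ 2) * hxy + hr
  refine (hiso.apply_one_le_apply_shear hrc hwz).trans_eq ?_
  rw [← hiso.apply_rotation_mul_mul_rotation !![u + w, z - v; z + v, u - w] hxy
    (by norm_num : (1 : ℝ) ^ 2 + 0 ^ 2 = 1)]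
  congr 1
  ext i j
  fin_cases i <;> fin_cases j <;> simp [Matrix.mul_apply, Fin.sum_univ_two] <;> linarith

/-- At the identity, `F` is supported from below by an affine function of the determinant. -/
theorem apply_one_mul_le_apply {p : ℝ} (hp : 2 ≤ p) (hF0 : ∀ A, 0 ≤ F A) (hiso : Isotropic F)
    (hrc : RankOneConvex F) (hhom : PosHomogeneous p F) (A : Matrix (Fin 2) (Fin 2) ℝ) :
    F 1 * (1 + p / 2 * (A.det - 1)) ≤ F A := by
  rcases le_or_gt A.det 0 with hd | hd
  · refine le_trans (mul_nonpos_of_nonneg_of_nonpos (hF0 1) ?_) (hF0 A)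
    nlinarith
  · set s := √A.det with hs
    have hs0 : 0 < s := Real.sqrt_pos.2 hd
    have hs2 : s ^ 2 = A.det := Real.sq_sqrt hd.le
    have h1 : F 1 ≤ F (s⁻¹ • A) := by
      refine hiso.apply_one_le_of_det_eq_one hrc ?_
      rw [Matrix.det_smul, ← hs2]
      simp; field_simp
    have h2 : F A = s ^ p * F (s⁻¹ • A) := by
      rw [← hhom _ _ hs0, smul_inv_smul₀ hs0.ne']
    have h3 : 1 + p / 2 * (A.det - 1) ≤ s ^ p := by
      have hb := one_add_mul_self_le_rpow_one_add (s := A.det - 1) (by linarith)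
        (p := p / 2) (by linarith)
      have : s ^ p = A.det ^ (p / 2) := by
        rw [← hs2, ← Real.rpow_natCast, ← Real.rpow_mul hs0.le]; congr 1; push_cast; ring
      rw [this]; simpa using hb
    rw [h2, mul_comm]
    exact mul_le_mul h3 h1 (hF0 1) (by positivity)


theorem exists_det_support_of_det_pos {p : ℝ} (hp : 2 ≤ p) (hF0 : ∀ A, 0 ≤ F A)
    (hiso : Isotropic F) (hrc : RankOneConvex F) (hhom : PosHomogeneous p F) {t : ℝ} (ht : 0 < t)
    {Q : Matrix (Fin 2) (Fin 2) ℝ} (hQ : Qᵀ * Q = 1) (hdet : Q.det = 1) :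
    ∃ c : ℝ, ∀ B, F (t • Q) + c * (B.det - (t • Q).det) ≤ F B := by
  refine ⟨t ^ p * F 1 * (p / 2) * (t ^ 2)⁻¹, fun B => ?_⟩
  have hA : F (t • Q) = t ^ p * F 1 := by
    rw [hhom _ _ ht, ← hiso 1 Q 1 hQ hdet (by simp) (by simp), mul_one, mul_one]
  have hB : F B = t ^ p * F (t⁻¹ • B) := by rw [← hhom _ _ ht, smul_inv_smul₀ ht.ne']
  have h := mul_le_mul_of_nonneg_left (apply_one_mul_le_apply hp hF0 hiso hrc hhom (t⁻¹ • B))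
    (Real.rpow_nonneg ht.le p)
  rw [hA, hB]
  refine le_trans (le_of_eq ?_) h
  rw [Matrix.det_smul, Matrix.det_smul, hdet]
  simp only [Fintype.card_fin]
  field_simp

/-- Precomposition with the reflection `diag(1, -1)` preserves isotropy. -/
theorem Isotropic.comp_reflection_mul (hiso : Isotropic F) :
    Isotropic fun A => F (!![1, 0; 0, -1] * A) := by
  set R : Matrix (Fin 2) (Fin 2) ℝ := !![1, 0; 0, -1] with hR
  have hRR : R * R = 1 := by simp [hR, Matrix.one_fin_two]
  have hRt : Rᵀ = R := by
    ext i j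
    fin_cases i <;> fin_cases j <;> simp [hR]
  have hRd : R.det = -1 := by simp [hR]
  intro A Q S hQ hQd hS hSd
  have h := hiso (R * A) (R * Q * R) S ?_ ?_ hS hSd
  · refine Eq.trans (congrArg F ?_) h
    simp only [Matrix.mul_assoc]
    rw [← Matrix.mul_assoc R R, hRR, Matrix.one_mul]
  · rw [Matrix.transpose_mul, Matrix.transpose_mul, hRt]
    calc R * (Qᵀ * R) * (R * Q * R) = R * (Qᵀ * (R * R) * Q) * R := by
          simp only [Matrix.mul_assoc]
      _ = 1 := by rw [hRR, Matrix.mul_one, hQ, Matrix.mul_one, hRR]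
  · rw [Matrix.det_mul, Matrix.det_mul, hRd, hQd]; norm_num

theorem RankOneConvex.comp_mul_left {n : ℕ} {F : Matrix (Fin n) (Fin n) ℝ → ℝ}
    (hrc : RankOneConvex F) {R : Matrix (Fin n) (Fin n) ℝ} (hR : IsUnit R.det) :
    RankOneConvex fun A => F (R * A) := by
  intro A X hX
  have h := hrc (R * A) (R * X) (by rwa [Matrix.rank_mul_eq_right_of_isUnit_det _ _ hR])
  simpa only [Matrix.mul_add, Matrix.mul_smul] using h

theorem PosHomogeneous.comp_mul_left {n : ℕ} {F : Matrix (Fin n) (Fin n) ℝ → ℝ} {p : ℝ}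
    (hhom : PosHomogeneous p F) (R : Matrix (Fin n) (Fin n) ℝ) :
    PosHomogeneous p fun A => F (R * A) := by
  intro A t ht
  simp only [Matrix.mul_smul, hhom _ t ht]

/-- At a conformal matrix, `F` is supported from below by an affine function of the
determinant. -/
theorem exists_det_support_of_mem_conformalSet {p : ℝ} (hp : 2 ≤ p) (hF0 : ∀ A, 0 ≤ F A)
    (hiso : Isotropic F) (hrc : RankOneConvex F) (hhom : PosHomogeneous p F)
    {A : Matrix (Fin 2) (Fin 2) ℝ} (hA : A ∈ ConformalSet 2) :
    ∃ c : ℝ, ∀ B, F A + c * (B.det - A.det) ≤ F B := by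
  have key : ∀ (t : ℝ) (Q : Matrix (Fin 2) (Fin 2) ℝ), 0 < t → Qᵀ * Q = 1 →
      ∃ c : ℝ, ∀ B, F (t • Q) + c * (B.det - (t • Q).det) ≤ F B := by
    intro t Q ht hQ
    have hd : Q.det * Q.det = 1 := by
      simpa [Matrix.det_mul, Matrix.det_transpose] using congrArg Matrix.det hQ
    rcases mul_self_eq_one_iff.1 hd with hd | hd
    · exact exists_det_support_of_det_pos hp hF0 hiso hrc hhom ht hQ hd
    · set R : Matrix (Fin 2) (Fin 2) ℝ := !![1, 0; 0, -1] with hR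
      have hRR : R * R = 1 := by simp [hR, Matrix.one_fin_two]
      have hRt : Rᵀ = R := by
        ext i j
        fin_cases i <;> fin_cases j <;> simp [hR]
      have hRd : R.det = -1 := by simp [hR]
      obtain ⟨c, hc⟩ := exists_det_support_of_det_pos hp (fun A => hF0 (R * A))
        hiso.comp_reflection_mul (hrc.comp_mul_left (by rw [hRd]; norm_num))
        (hhom.comp_mul_left R) ht (Q := R * Q)
        (by rw [Matrix.transpose_mul, hRt, Matrix.mul_assoc, ← Matrix.mul_assoc R R, hRR,
          Matrix.one_mul, hQ])
        (by rw [Matrix.det_mul, hRd, hd]; norm_num)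
      refine ⟨-c, fun B => ?_⟩
      have h := hc (R * B)
      rw [← Matrix.mul_smul, ← Matrix.mul_assoc, ← Matrix.mul_assoc, hRR, Matrix.one_mul,
        Matrix.one_mul, Matrix.det_mul, Matrix.det_mul, hRd] at h
      linarith
  obtain ⟨t, Q, hQ, rfl⟩ := hA
  rcases lt_trichotomy t 0 with ht | rfl | ht
  · simpa using key (-t) (-Q) (by linarith) (by simpa using hQ)
  · have h0 : F 0 = 0 := by
      have h := hhom 0 2 two_pos
      have h2 : (1 : ℝ) < 2 ^ p := Real.one_lt_rpow one_lt_two (by linarith)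
      rw [smul_zero] at h
      nlinarith [hF0 0]
    exact ⟨0, fun B => by simpa [h0] using hF0 B⟩
  · exact key t Q ht hQ

end Algebra

section Analysis

open Filter Topology

variable {E : Type*} [NormedAddCommGroup E] [NormedSpace ℝ E] [FiniteDimensional ℝ E]
  [MeasurableSpace E] [BorelSpace E] {μ : Measure E} [μ.IsAddHaarMeasure]

/-- The derivative of a Lipschitz map vanishes almost everywhere on its zero set. -/
theorem LipschitzWith.ae_fderiv_eq_zero_of_eqOn_zero {φ : E → E} {K : NNReal}
    (hφ : LipschitzWith K φ) {s : Set E} (hs : MeasurableSet s) (h0 : ∀ x ∈ s, φ x = 0) :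
    ∀ᵐ x ∂μ, x ∈ s → fderiv ℝ φ x = 0 := by
  set D := {x | DifferentiableAt ℝ φ x} with hD
  have hDm : MeasurableSet D := measurableSet_of_differentiableAt ℝ φ
  have happ : ApproximatesLinearOn φ (0 : E →L[ℝ] E) (s ∩ D) 0 :=
    LipschitzOnWith.approximatesLinearOn <| by
      intro x hx y hy
      simp [h0 x hx.1, h0 y hy.1]
  have h := happ.norm_fderiv_sub_le μ (hs.inter hDm) (fderiv ℝ φ)
    fun x hx => hx.2.hasFDerivAt.hasFDerivWithinAt
  rw [ae_restrict_iff' (hs.inter hDm)] at h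
  filter_upwards [h, hφ.ae_differentiableAt (μ := μ)] with x hx hdx hxs
  simpa using hx ⟨hxs, hdx⟩

theorem LipschitzWith.integral_lineDeriv_eq_zero {f : E → ℝ} {K : NNReal}
    (hf : LipschitzWith K f) (hfc : HasCompactSupport f) (v : E) :
    ∫ x, lineDeriv ℝ f x v ∂μ = 0 := by
  have h := (LipschitzWith.const' (K := 0) (1 : ℝ)).integral_lineDeriv_mul_eq (μ := μ)
    hf hfc (-v)
  have h1 : ∀ x : E, lineDeriv ℝ (fun _ : E => (1 : ℝ)) x (-v) = 0 := fun x => by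
    simp [lineDeriv]
  simpa [h1] using h.symm

theorem integrable_lineDeriv_of_lipschitz {f : E → ℝ} {K : NNReal}
    (hf : LipschitzWith K f) (hfc : HasCompactSupport f) (v : E) :
    Integrable (fun x => lineDeriv ℝ f x v) μ := by
  have hsupp : ∀ x ∉ tsupport f, lineDeriv ℝ f x v = 0 := by
    intro x hx
    have : f =ᶠ[𝓝 x] fun _ => 0 := notMem_tsupport_iff_eventuallyEq.1 hx
    rw [this.lineDeriv_eq]
    simp [lineDeriv]
  have hint : IntegrableOn (fun x => lineDeriv ℝ f x v) (tsupport f) μ :=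
    (hf.locallyIntegrable_lineDeriv v).integrableOn_isCompact hfc
  exact (integrableOn_iff_integrable_of_support_subset fun x hx => by
    by_contra h; exact hx (hsupp x h)).1 hint

/-- Mixed line derivatives of compactly supported Lipschitz functions may be exchanged under the
integral sign. -/
theorem LipschitzWith.integral_lineDeriv_mul_lineDeriv_comm {f g : E → ℝ} {K L : NNReal}
    (hf : LipschitzWith K f) (hfc : HasCompactSupport f)
    (hg : LipschitzWith L g) (hgc : HasCompactSupport g) (u v : E) :
    ∫ x, lineDeriv ℝ f x u * lineDeriv ℝ g x v ∂μ =
      ∫ x, lineDeriv ℝ f x v * lineDeriv ℝ g x u ∂μ := by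
  have hfi := integrable_lineDeriv_of_lipschitz (μ := μ) hf hfc v
  have hgi := integrable_lineDeriv_of_lipschitz (μ := μ) hg hgc v
  have htend := hf.integral_inv_smul_sub_mul_tendsto_integral_lineDeriv_mul hgi u
  have htend' := (hg.integral_inv_smul_sub_mul_tendsto_integral_lineDeriv_mul hfi (-u)).neg
  have hlip : ∀ a : E, LipschitzWith L fun x => g (x + a) := fun a => by
    simpa [Function.comp_def] using hg.comp (LipschitzWith.id.add (LipschitzWith.const a))
  obtain ⟨Cf, hCf⟩ := hfc.exists_bound_of_continuous hf.continuous
  obtain ⟨Cg, hCg⟩ := hgc.exists_bound_of_continuous hg.continuous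
  have hfint : ∀ a : E, Integrable (fun x => f (x + a) * lineDeriv ℝ g x v) μ := fun a =>
    hgi.bdd_mul (hf.continuous.comp (continuous_add_const a)).aestronglyMeasurable
      (.of_forall fun x => hCf (x + a))
  have hgint : ∀ a : E, Integrable (fun x => lineDeriv ℝ f x v * g (x + a)) μ := fun a =>
    hfi.mul_bdd (hg.continuous.comp (continuous_add_const a)).aestronglyMeasurable
      (.of_forall fun x => hCg (x + a))
  have hparts : ∀ a : E, ∫ x, f (x - a) * lineDeriv ℝ g x v ∂μ =
      -∫ x, lineDeriv ℝ f x v * g (x + a) ∂μ := by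
    intro a
    rw [← integral_add_right_eq_self _ a]
    have hshift : ∀ x, lineDeriv ℝ g (x + a) v = lineDeriv ℝ (fun y => g (y + a)) x v :=
      fun x => by simp only [lineDeriv, add_right_comm]
    have h := (hlip a).integral_lineDeriv_mul_eq (μ := μ) hf hfc v
    simp only [lineDeriv_neg, neg_mul, integral_neg] at h
    rw [← h]
    simp only [hshift, add_sub_cancel_right, mul_comm]
  have heq : ∀ t : ℝ, ∫ x, (t⁻¹ • (f (x + t • u) - f x)) * lineDeriv ℝ g x v ∂μ =
      -∫ x, (t⁻¹ • (g (x + t • -u) - g x)) * lineDeriv ℝ f x v ∂μ := by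
    intro t
    have h1 := hparts (-(t • u))
    have h2 := hparts 0
    simp only [sub_neg_eq_add, sub_zero, add_zero] at h1 h2
    have i2 := hfint 0
    have i4 := hgint 0
    simp only [add_zero] at i2 i4
    calc _ = t⁻¹ * ∫ x, f (x + t • u) * lineDeriv ℝ g x v - f x * lineDeriv ℝ g x v ∂μ := by
          rw [← integral_const_mul]; congr 1; ext x; simp only [smul_eq_mul]; ring
      _ = -(t⁻¹ * ∫ x, lineDeriv ℝ f x v * g (x + -(t • u)) - lineDeriv ℝ f x v * g x ∂μ) := by
          rw [integral_sub (hfint _) i2, integral_sub (hgint _) i4, h1, h2]; ring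
      _ = _ := by
          rw [← integral_const_mul]; congr 2; ext x; simp only [smul_eq_mul, smul_neg]; ring
  simp only [heq] at htend
  rw [tendsto_nhds_unique htend htend', ← integral_neg]
  congr 1
  ext x
  rw [lineDeriv_neg]
  ring

end Analysis

section Gradient

variable {φ : (Fin 2 → ℝ) → (Fin 2 → ℝ)} {K : NNReal}

theorem LipschitzWith.apply_coord (hφ : LipschitzWith K φ) (i : Fin 2) :
    LipschitzWith K fun x => φ x i := by
  simpa [Function.comp_def] using (LipschitzWith.eval i).comp hφ

theorem LipschitzWith.ae_gradMat_eq_lineDeriv (hφ : LipschitzWith K φ) :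
    ∀ᵐ x, ∀ i j, gradMat φ x i j = lineDeriv ℝ (fun y => φ y i) x (Pi.single j 1) := by
  filter_upwards [hφ.ae_differentiableAt (μ := volume)] with x hx i j
  have hi : HasFDerivAt (fun y => φ y i) ((ContinuousLinearMap.proj i).comp (fderiv ℝ φ x)) x :=
    hasFDerivAt_pi'.1 hx.hasFDerivAt i
  rw [hi.differentiableAt.lineDeriv_eq_fderiv, hi.fderiv]
  rfl

theorem LipschitzWith.abs_gradMat_apply_le (hφ : LipschitzWith K φ) (x : Fin 2 → ℝ)
    (i j : Fin 2) : |gradMat φ x i j| ≤ K := by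
  have h1 : ‖fderiv ℝ φ x (Pi.single j 1)‖ ≤ K * ‖(Pi.single j 1 : Fin 2 → ℝ)‖ :=
    (fderiv ℝ φ x).le_of_opNorm_le (norm_fderiv_le_of_lipschitz ℝ hφ) _
  have h2 : ‖(Pi.single j 1 : Fin 2 → ℝ)‖ = 1 := by
    rw [Pi.norm_single, norm_one]
  rw [h2, mul_one] at h1
  exact (norm_le_pi_norm _ i).trans h1

theorem measurable_gradMat_apply (φ : (Fin 2 → ℝ) → (Fin 2 → ℝ)) (i j : Fin 2) :
    Measurable fun x => gradMat φ x i j :=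
  (measurable_pi_apply i).comp (measurable_fderiv_apply_const ℝ φ (Pi.single j 1))

theorem stronglyMeasurable_gradMat (φ : (Fin 2 → ℝ) → (Fin 2 → ℝ)) :
    StronglyMeasurable (gradMat φ) :=
  have h : Measurable fun (x : Fin 2 → ℝ) (i j : Fin 2) => gradMat φ x i j :=
    measurable_pi_iff.2 fun i => measurable_pi_iff.2 fun j => measurable_gradMat_apply φ i j
  h.stronglyMeasurable

/-- A continuous integrand evaluated along `A + Dφ` is integrable on sets of finite measure. -/
theorem LipschitzWith.integrableOn_comp_gradMat (hφ : LipschitzWith K φ)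
    {F : Matrix (Fin 2) (Fin 2) ℝ → ℝ} (hF : Continuous F) (A : Matrix (Fin 2) (Fin 2) ℝ)
    {Ω : Set (Fin 2 → ℝ)} (hΩ : volume Ω ≠ ⊤) :
    IntegrableOn (fun x => F (A + gradMat φ x)) Ω := by
  have hcont : Continuous fun M : Matrix (Fin 2) (Fin 2) ℝ => F (A + M) :=
    hF.comp (continuous_const.add continuous_id)
  let S : Set (Matrix (Fin 2) (Fin 2) ℝ) :=
    Set.pi univ fun _ => Set.pi univ fun _ => Icc (-(K : ℝ)) K
  have hS : IsCompact S := isCompact_univ_pi fun _ => isCompact_univ_pi fun _ => isCompact_Icc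
  obtain ⟨C, hC⟩ := hS.exists_bound_of_continuousOn hcont.continuousOn
  refine IntegrableOn.of_bound hΩ.lt_top
    (hcont.comp_stronglyMeasurable (stronglyMeasurable_gradMat φ)).aestronglyMeasurable C
    (.of_forall fun x => hC _ fun i _ j _ => abs_le.1 (hφ.abs_gradMat_apply_le x i j))

variable {Ω : Set (Fin 2 → ℝ)}

theorem LipschitzWith.setIntegral_gradMat_eq_integral (hφ : LipschitzWith K φ)
    (hΩ : MeasurableSet Ω) (h0 : ∀ x ∉ Ω, φ x = 0) {H : Matrix (Fin 2) (Fin 2) ℝ → ℝ}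
    (hH : H 0 = 0) : ∫ x in Ω, H (gradMat φ x) = ∫ x, H (gradMat φ x) := by
  refine setIntegral_eq_integral_of_ae_compl_eq_zero ?_
  filter_upwards [hφ.ae_fderiv_eq_zero_of_eqOn_zero hΩ.compl h0] with x hx hxΩ
  have : gradMat φ x = 0 := by
    ext i j
    simp [gradMat, hx hxΩ]
  rw [this, hH]

theorem hasCompactSupport_coord (hΩb : Bornology.IsBounded Ω) (h0 : ∀ x ∉ Ω, φ x = 0)
    (i : Fin 2) : HasCompactSupport fun x => φ x i :=
  HasCompactSupport.of_support_subset_isCompact hΩb.isCompact_closure fun x hx => by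
    by_contra h
    exact hx (congrFun (h0 x fun hx' => h (subset_closure hx')) i)

theorem LipschitzWith.integral_gradMat_apply (hφ : LipschitzWith K φ)
    (hΩb : Bornology.IsBounded Ω) (h0 : ∀ x ∉ Ω, φ x = 0) (i j : Fin 2) :
    ∫ x, gradMat φ x i j = 0 := by
  rw [← (hφ.apply_coord i).integral_lineDeriv_eq_zero (hasCompactSupport_coord hΩb h0 i)
    (Pi.single j 1) (μ := volume)]
  refine integral_congr_ae ?_
  filter_upwards [hφ.ae_gradMat_eq_lineDeriv] with x hx using hx i j

theorem LipschitzWith.integral_gradMat_mul_comm (hφ : LipschitzWith K φ)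
    (hΩb : Bornology.IsBounded Ω) (h0 : ∀ x ∉ Ω, φ x = 0) :
    ∫ x, gradMat φ x 0 0 * gradMat φ x 1 1 = ∫ x, gradMat φ x 0 1 * gradMat φ x 1 0 := by
  have h := (hφ.apply_coord 0).integral_lineDeriv_mul_lineDeriv_comm
    (hasCompactSupport_coord hΩb h0 0) (hφ.apply_coord 1) (hasCompactSupport_coord hΩb h0 1)
    (Pi.single 0 1) (Pi.single 1 1) (μ := volume)
  convert h using 1 <;> refine integral_congr_ae ?_ <;>
    filter_upwards [hφ.ae_gradMat_eq_lineDeriv] with x hx <;> simp only [hx]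

/-- The determinant is a null Lagrangian. -/
theorem LipschitzWith.setIntegral_det_add_gradMat (hφ : LipschitzWith K φ)
    (hΩ : MeasurableSet Ω) (hΩb : Bornology.IsBounded Ω) (h0 : ∀ x ∉ Ω, φ x = 0)
    (A : Matrix (Fin 2) (Fin 2) ℝ) :
    ∫ x in Ω, ((A + gradMat φ x).det - A.det) = 0 := by
  have hvol : volume Ω ≠ ⊤ := hΩb.measure_lt_top.ne
  have hint : ∀ {H : Matrix (Fin 2) (Fin 2) ℝ → ℝ}, Continuous H →
      IntegrableOn (fun x => H (gradMat φ x)) Ω := fun hH => by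
    simpa using hφ.integrableOn_comp_gradMat hH 0 hvol
  have hlin : ∀ i j, ∫ x in Ω, gradMat φ x i j = 0 := fun i j => by
    rw [hφ.setIntegral_gradMat_eq_integral hΩ h0 (H := fun M => M i j) rfl,
      hφ.integral_gradMat_apply hΩb h0]
  have hmul : ∫ x in Ω, gradMat φ x 0 0 * gradMat φ x 1 1 =
      ∫ x in Ω, gradMat φ x 0 1 * gradMat φ x 1 0 := by
    rw [hφ.setIntegral_gradMat_eq_integral hΩ h0 (H := fun M => M 0 0 * M 1 1) (by simp),
      hφ.setIntegral_gradMat_eq_integral hΩ h0 (H := fun M => M 0 1 * M 1 0) (by simp),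
      hφ.integral_gradMat_mul_comm hΩb h0]
  have hentry : ∀ i j, IntegrableOn (fun x => gradMat φ x i j) Ω := fun i j =>
    hint (H := fun M => M i j) (by fun_prop)
  have hprod : ∀ i j k l, IntegrableOn (fun x => gradMat φ x i j * gradMat φ x k l) Ω :=
    fun i j k l => hint (H := fun M => M i j * M k l) (by fun_prop)
  calc ∫ x in Ω, ((A + gradMat φ x).det - A.det)
      = ∫ x in Ω, (((A 0 0 * gradMat φ x 1 1 + A 1 1 * gradMat φ x 0 0) -
          (A 0 1 * gradMat φ x 1 0 + A 1 0 * gradMat φ x 0 1)) +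
          (gradMat φ x 0 0 * gradMat φ x 1 1 - gradMat φ x 0 1 * gradMat φ x 1 0)) := by
        congr 1
        ext x
        simp only [Matrix.det_fin_two, Matrix.add_apply]
        ring
    _ = 0 := by
        have i1 := ((hentry 1 1).const_mul (A 0 0))
        have i2 := ((hentry 0 0).const_mul (A 1 1))
        have i3 := ((hentry 1 0).const_mul (A 0 1))
        have i4 := ((hentry 0 1).const_mul (A 1 0))
        have i12 : IntegrableOn (fun x => A 0 0 * gradMat φ x 1 1 + A 1 1 * gradMat φ x 0 0) Ω :=
          i1.add i2
        have i34 : IntegrableOn (fun x => A 0 1 * gradMat φ x 1 0 + A 1 0 * gradMat φ x 0 1) Ω :=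
          i3.add i4
        have i1234 : IntegrableOn (fun x =>
            (A 0 0 * gradMat φ x 1 1 + A 1 1 * gradMat φ x 0 0) -
              (A 0 1 * gradMat φ x 1 0 + A 1 0 * gradMat φ x 0 1)) Ω := i12.sub i34
        have idet : IntegrableOn (fun x => gradMat φ x 0 0 * gradMat φ x 1 1 -
            gradMat φ x 0 1 * gradMat φ x 1 0) Ω := (hprod 0 0 1 1).sub (hprod 0 1 1 0)
        rw [integral_add i1234 idet, integral_sub i12 i34, integral_add i1 i2, integral_add i3 i4,
          integral_sub (hprod 0 0 1 1) (hprod 0 1 1 0), hmul]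
        simp only [integral_const_mul, hlin]
        ring

end Gradient

/-- If `p ≥ 2` and `F : ℝ^{2×2} → [0,∞)` is continuous, isotropic,
rank-one convex and positively `p`-homogeneous, then `F` is quasiconvex at every
conformal matrix. -/
theorem stmt_1 (p : ℝ) (hp : 2 ≤ p) (F : Matrix (Fin 2) (Fin 2) ℝ → ℝ)
    (hFc : Continuous F) (hF0 : ∀ A, 0 ≤ F A) (hiso : Isotropic F)
    (hrc : RankOneConvex F) (hhom : PosHomogeneous p F) :
    ∀ A ∈ ConformalSet 2, QuasiconvexAt F A := by
  intro A hA Ω hΩ hΩb φ K hφ h0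
  obtain ⟨c, hc⟩ := exists_det_support_of_mem_conformalSet hp hF0 hiso hrc hhom hA
  have hvol : volume Ω ≠ ⊤ := hΩb.measure_lt_top.ne
  have hdet : IntegrableOn (fun x => (A + gradMat φ x).det - A.det) Ω :=
    hφ.integrableOn_comp_gradMat (F := fun M => M.det - A.det)
      ((continuous_id.matrix_det).sub continuous_const) A hvol
  have hconst : IntegrableOn (fun _ => F A) Ω := integrableOn_const hvol
  calc F A * (volume Ω).toReal
      = ∫ x in Ω, (F A + c * ((A + gradMat φ x).det - A.det)) := by
        rw [integral_add hconst (hdet.const_mul c), integral_const_mul,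
          hφ.setIntegral_det_add_gradMat hΩ.measurableSet hΩb h0, setIntegral_const]
        simp [Measure.real, mul_comm]
    _ ≤ ∫ x in Ω, F (A + gradMat φ x) :=
        integral_mono (hconst.add (hdet.const_mul c))
          (hφ.integrableOn_comp_gradMat hFc A hvol) fun x => hc _
end

section
/- Let F : ℝ^{n×n} → ℝ be continuous, rank-one convex and isotropic. Then the infimum of F over all of ℝ^{n×n} equals the infimum of F over the set of conformal matrices CO(n) = {tQ : Q ∈ O(n), t ∈ ℝ}. -/
open Matrix MeasureTheory Set

/-- The Householder reflection in the hyperplane orthogonal to `u` (the identity if `u = 0`). -/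
noncomputable def householder {n : ℕ} (u : Fin n → ℝ) : Matrix (Fin n) (Fin n) ℝ :=
  1 - (2 / (u ⬝ᵥ u)) • vecMulVec u u

theorem householder_transpose {n : ℕ} (u : Fin n → ℝ) : (householder u)ᵀ = householder u := by
  simp [householder, transpose_sub, transpose_smul, transpose_vecMulVec]

theorem householder_transpose_mul_self {n : ℕ} (u : Fin n → ℝ) :
    (householder u)ᵀ * householder u = 1 := by
  rw [householder_transpose]
  by_cases hu : u = 0
  · simp [householder, hu]
  have hk : u ⬝ᵥ u ≠ 0 := fun h => hu (dotProduct_self_eq_zero.1 h)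
  ext i j
  simp only [householder, mul_sub, sub_mul, Matrix.mul_one, Matrix.one_mul, Matrix.smul_mul,
    Matrix.mul_smul, vecMulVec_mul_vecMulVec, Matrix.sub_apply, Matrix.smul_apply, vecMulVec_apply, smul_eq_mul,
    Pi.smul_apply]
  field_simp
  ring

theorem det_householder {n : ℕ} {u : Fin n → ℝ} (hu : u ≠ 0) : (householder u).det = -1 := by
  have hk : u ⬝ᵥ u ≠ 0 := fun h => hu (dotProduct_self_eq_zero.1 h)
  have h : householder u = 1 + replicateCol Unit (-(2 / (u ⬝ᵥ u)) • u) * replicateRow Unit u := by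
    rw [← vecMulVec_eq, smul_vecMulVec, neg_smul, ← sub_eq_add_neg, householder]
  rw [h, det_one_add_replicateCol_mul_replicateRow, dotProduct_smul, smul_eq_mul]
  field_simp
  norm_num

theorem householder_mulVec_mul_mul_householder {n : ℕ} (M : Matrix (Fin n) (Fin n) ℝ)
    (u : Fin n → ℝ) (hp : M *ᵥ u ≠ 0) :
    householder (M *ᵥ u) * M * householder u =
      M - (2 : ℝ) • vecMulVec (M *ᵥ u)
        (((M *ᵥ u) ⬝ᵥ (M *ᵥ u))⁻¹ • (Mᵀ *ᵥ (M *ᵥ u)) - (u ⬝ᵥ u)⁻¹ • u) := by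
  have hq : (M *ᵥ u) ⬝ᵥ (M *ᵥ u) ≠ 0 := fun h => hp (dotProduct_self_eq_zero.1 h)
  have hk : u ⬝ᵥ u ≠ 0 := fun h => hp (by rw [dotProduct_self_eq_zero.1 h, mulVec_zero])
  have hd : (M *ᵥ u) ᵥ* M ⬝ᵥ u = (M *ᵥ u) ⬝ᵥ (M *ᵥ u) := (dotProduct_mulVec _ _ _).symm
  ext i j
  simp only [householder, mul_sub, sub_mul, Matrix.mul_one, Matrix.one_mul, Matrix.smul_mul,
    Matrix.mul_smul, vecMulVec_mul, mul_vecMulVec, vecMulVec_mulVec, mulVec_transpose, Matrix.sub_apply,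
    Matrix.smul_apply, vecMulVec_apply, smul_eq_mul, Pi.smul_apply, Pi.sub_apply, smul_mulVec,
    hd, MulOpposite.smul_eq_mul_unop, MulOpposite.unop_op]
  field_simp
  ring

theorem exists_orthogonal_mul_mul_eq_self {n : ℕ} (M : Matrix (Fin n) (Fin n) ℝ) (hM : M ≠ 0) :
    ∃ Q R : Matrix (Fin n) (Fin n) ℝ, Qᵀ * Q = 1 ∧ Q.det = -1 ∧ Rᵀ * R = 1 ∧ R.det = -1 ∧
      Q * M * R = M := by
  have hG : (Mᵀ * M).IsHermitian := by
    simpa [conjTranspose_eq_transpose_of_trivial] using isHermitian_conjTranspose_mul_self M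
  have hG0 : Mᵀ * M ≠ 0 := fun h => hM <| by
    rwa [← conjTranspose_eq_transpose_of_trivial, conjTranspose_mul_self_eq_zero] at h
  obtain ⟨u, t, ht, hu, hut⟩ := hG.exists_eigenvector_of_ne_zero hG0
  have hp : M *ᵥ u ≠ 0 := fun h => by
    rw [← mulVec_mulVec, h, mulVec_zero] at hut
    exact smul_ne_zero ht hu hut.symm
  have hk : u ⬝ᵥ u ≠ 0 := fun h => hu (dotProduct_self_eq_zero.1 h)
  have hq : (M *ᵥ u) ⬝ᵥ (M *ᵥ u) = t * (u ⬝ᵥ u) := by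
    rw [dotProduct_mulVec, ← mulVec_transpose, mulVec_mulVec, hut, smul_dotProduct, smul_eq_mul]
  refine ⟨householder (M *ᵥ u), householder u, householder_transpose_mul_self _,
    det_householder hp, householder_transpose_mul_self _, det_householder hu, ?_⟩
  rw [householder_mulVec_mul_mul_householder M u hp, mulVec_mulVec, hut, hq, smul_smul, mul_inv,
    mul_right_comm, inv_mul_cancel₀ ht, one_mul, sub_self, vecMulVec_zero, smul_zero, sub_zero]

theorem Isotropic.apply_mul_mul_of_det_eq_neg_one {n : ℕ} {F : Matrix (Fin n) (Fin n) ℝ → ℝ}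
    (hF : Isotropic F) {M : Matrix (Fin n) (Fin n) ℝ} (hM : M ≠ 0)
    {Q R : Matrix (Fin n) (Fin n) ℝ} (hQ : Qᵀ * Q = 1) (hQd : Q.det = -1) (hR : Rᵀ * R = 1)
    (hRd : R.det = -1) : F (Q * M * R) = F M := by
  obtain ⟨Q', R', hQ', hQd', hR', hRd', h⟩ := exists_orthogonal_mul_mul_eq_self M hM
  have horth : ∀ A B : Matrix (Fin n) (Fin n) ℝ, Aᵀ * A = 1 → Bᵀ * B = 1 →
      (A * B)ᵀ * (A * B) = 1 := fun A B hA hB => by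
    rw [transpose_mul, Matrix.mul_assoc, ← Matrix.mul_assoc Aᵀ, hA, Matrix.one_mul, hB]
  conv_lhs => rw [← h]
  rw [show Q * (Q' * M * R') * R = Q * Q' * M * (R' * R) by simp only [Matrix.mul_assoc]]
  exact hF _ _ _ (horth _ _ hQ hQ') (by simp [hQd, hQd']) (horth _ _ hR' hR) (by simp [hRd, hRd'])

theorem rank_vecMulVec_eq_one {n : ℕ} {p z : Fin n → ℝ} (hp : p ≠ 0) (hz : z ≠ 0) :
    (vecMulVec p z).rank = 1 := by
  refine le_antisymm (rank_vecMulVec_le p z) (Nat.one_le_iff_ne_zero.2 fun h => ?_)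
  rw [rank, Submodule.finrank_eq_zero, LinearMap.range_eq_bot] at h
  exact vecMulVec_ne_zero hp hz (Matrix.toLin'.injective (by rw [map_zero]; exact h))

theorem RankOneConvex.apply_sub_le {n : ℕ} {F : Matrix (Fin n) (Fin n) ℝ → ℝ}
    (hF : RankOneConvex F) {M X : Matrix (Fin n) (Fin n) ℝ} (hX : X.rank = 1)
    (h : F (M - (2 : ℝ) • X) = F M) : F (M - X) ≤ F M := by
  have := (hF M X hX).2 (mem_univ (0 : ℝ)) (mem_univ (-2 : ℝ))
    (by norm_num : (0 : ℝ) ≤ 1 / 2) (by norm_num : (0 : ℝ) ≤ 1 / 2) (by norm_num)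
  norm_num [← sub_eq_add_neg, h] at this
  linarith

theorem sum_sq_sub_vecMulVec {n : ℕ} (M : Matrix (Fin n) (Fin n) ℝ) (p z : Fin n → ℝ) :
    ∑ i, ∑ j, (M - vecMulVec p z) i j ^ 2 =
      ∑ i, ∑ j, M i j ^ 2 - 2 * ((Mᵀ *ᵥ p) ⬝ᵥ z) + (p ⬝ᵥ p) * (z ⬝ᵥ z) := by
  rw [mulVec_transpose, ← dotProduct_mulVec]
  simp only [dotProduct, mulVec, Finset.mul_sum, Finset.sum_mul]
  rw [Finset.sum_comm (f := fun i j => p j * p j * (z i * z i)), ← Finset.sum_sub_distrib,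
    ← Finset.sum_add_distrib]
  refine Finset.sum_congr rfl fun i _ => ?_
  rw [← Finset.sum_sub_distrib, ← Finset.sum_add_distrib]
  refine Finset.sum_congr rfl fun j _ => ?_
  rw [Matrix.sub_apply, vecMulVec_apply]
  ring

/-- If `u` is not a right singular vector of `M`, then a matrix of smaller Frobenius norm lies on
a rank-one segment whose endpoints are `M` and a matrix in the isotropy class of `M`. -/
theorem exists_apply_le_sum_sq_lt {n : ℕ} {F : Matrix (Fin n) (Fin n) ℝ → ℝ}
    (hrc : RankOneConvex F) (hiso : Isotropic F) (M : Matrix (Fin n) (Fin n) ℝ) (u : Fin n → ℝ)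
    (hu : ∀ c : ℝ, (Mᵀ * M) *ᵥ u ≠ c • u) :
    ∃ N, F N ≤ F M ∧ ∑ i, ∑ j, N i j ^ 2 < ∑ i, ∑ j, M i j ^ 2 := by
  have hp : M *ᵥ u ≠ 0 := fun h => hu 0 (by rw [← mulVec_mulVec, h, mulVec_zero, zero_smul])
  have hM : M ≠ 0 := fun h => hp (by rw [h, zero_mulVec])
  have hu0 : u ≠ 0 := fun h => hp (by rw [h, mulVec_zero])
  have hk : u ⬝ᵥ u ≠ 0 := fun h => hu0 (dotProduct_self_eq_zero.1 h)
  have hq : (M *ᵥ u) ⬝ᵥ (M *ᵥ u) ≠ 0 := fun h => hp (dotProduct_self_eq_zero.1 h)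
  have hq0 : 0 < (M *ᵥ u) ⬝ᵥ (M *ᵥ u) :=
    lt_of_le_of_ne (Finset.sum_nonneg fun i _ => mul_self_nonneg _) hq.symm
  have hrefl := householder_mulVec_mul_mul_householder M u hp
  set p := M *ᵥ u with hpdef
  set q := p ⬝ᵥ p with hqdef
  set k := u ⬝ᵥ u with hkdef
  set z := q⁻¹ • (Mᵀ *ᵥ p) - k⁻¹ • u with hzdef
  have hMp : Mᵀ *ᵥ p = q • z + (q / k) • u := by
    rw [hzdef, smul_sub, smul_smul, smul_smul, mul_inv_cancel₀ hq, one_smul, div_eq_mul_inv,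
      sub_add_cancel]
  have hz : z ≠ 0 := fun h => hu (q / k) (by
    rw [← mulVec_mulVec, ← hpdef, hMp, h, smul_zero, zero_add])
  have huz : u ⬝ᵥ z = 0 := by
    rw [hzdef, dotProduct_sub, dotProduct_smul, dotProduct_smul, dotProduct_mulVec,
      vecMul_transpose, ← hpdef, ← hqdef, ← hkdef, smul_eq_mul, smul_eq_mul, inv_mul_cancel₀ hq,
      inv_mul_cancel₀ hk, sub_self]
  have hzz : 0 < z ⬝ᵥ z :=
    lt_of_le_of_ne (Finset.sum_nonneg fun i _ => mul_self_nonneg _)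
      fun h => hz (dotProduct_self_eq_zero.1 h.symm)
  refine ⟨M - vecMulVec p z, hrc.apply_sub_le (rank_vecMulVec_eq_one hp hz) ?_, ?_⟩
  · rw [← hrefl]
    exact hiso.apply_mul_mul_of_det_eq_neg_one hM (householder_transpose_mul_self _)
      (det_householder hp) (householder_transpose_mul_self _) (det_householder hu0)
  · rw [sum_sq_sub_vecMulVec, hMp, add_dotProduct, smul_dotProduct, smul_dotProduct, huz,
      smul_eq_mul, smul_zero, ← hqdef]
    nlinarith [mul_pos hq0 hzz]

theorem mem_conformalSet_of_forall_mulVec {n : ℕ} (M : Matrix (Fin n) (Fin n) ℝ)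
    (h : ∀ u : Fin n → ℝ, ∃ c : ℝ, (Mᵀ * M) *ᵥ u = c • u) : M ∈ ConformalSet n := by
  obtain ⟨c, hc⟩ := LinearMap.exists_eq_smul_id_of_forall_notLinearIndependent
    (f := Matrix.toLin' (Mᵀ * M)) fun u hli => by
      obtain ⟨a, ha⟩ := h u
      have := (LinearIndependent.pair_iff.1 hli) a (-1) (by simp [ha])
      norm_num at this
  have hG : Mᵀ * M = c • (1 : Matrix (Fin n) (Fin n) ℝ) := by
    apply Matrix.toLin'.injective
    rw [hc, map_smul, toLin'_one]
    rfl
  by_cases hM : M = 0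
  · exact ⟨0, 1, by simp, by simp [hM]⟩
  have hc0 : 0 < c := by
    obtain ⟨i, j, hij⟩ : ∃ i j, M i j ≠ 0 := by
      by_contra! hcon
      exact hM (by ext i j; exact hcon i j)
    have hjj : ∑ k, M k j * M k j = c := by
      simpa [mul_apply] using congrFun (congrFun hG j) j
    rw [← hjj]
    exact Finset.sum_pos' (fun k _ => mul_self_nonneg _) ⟨i, Finset.mem_univ i,
      mul_self_pos.2 hij⟩
  have hs : Real.sqrt c ≠ 0 := (Real.sqrt_pos.2 hc0).ne'
  refine ⟨Real.sqrt c, (Real.sqrt c)⁻¹ • M, ?_, by rw [smul_smul, mul_inv_cancel₀ hs, one_smul]⟩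
  rw [transpose_smul, Matrix.smul_mul, Matrix.mul_smul, hG, smul_smul, smul_smul, ← mul_inv,
    Real.mul_self_sqrt hc0.le, inv_mul_cancel₀ hc0.ne', one_smul]

theorem isCompact_setOf_sum_sq_le {n : ℕ} (r : ℝ) :
    IsCompact {M : Matrix (Fin n) (Fin n) ℝ | ∑ i, ∑ j, M i j ^ 2 ≤ r} := by
  have hbox : IsCompact (Set.univ.pi fun _ : Fin n => Set.univ.pi fun _ : Fin n =>
      Set.Icc (-Real.sqrt r) (Real.sqrt r)) :=
    isCompact_univ_pi fun _ => isCompact_univ_pi fun _ => isCompact_Icc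
  refine hbox.of_isClosed_subset (isClosed_le (by fun_prop) continuous_const) ?_
  intro M hM i _ j _
  rw [mem_Icc, ← abs_le]
  refine Real.abs_le_sqrt (le_trans ?_ hM)
  exact (Finset.single_le_sum (f := fun j => M i j ^ 2) (fun j _ => sq_nonneg _)
    (Finset.mem_univ j)).trans (Finset.single_le_sum (f := fun i => ∑ j, M i j ^ 2)
      (fun i _ => Finset.sum_nonneg fun j _ => sq_nonneg _) (Finset.mem_univ i))

theorem exists_mem_conformalSet_apply_le {n : ℕ} {F : Matrix (Fin n) (Fin n) ℝ → ℝ}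
    (hFc : Continuous F) (hrc : RankOneConvex F) (hiso : Isotropic F)
    (A : Matrix (Fin n) (Fin n) ℝ) : ∃ M ∈ ConformalSet n, F M ≤ F A := by
  have hK := (isCompact_setOf_sum_sq_le (n := n) (∑ i, ∑ j, A i j ^ 2)).inter_right
    (isClosed_le hFc (continuous_const (y := F A)))
  have hcont : Continuous fun M : Matrix (Fin n) (Fin n) ℝ => ∑ i, ∑ j, M i j ^ 2 := by fun_prop
  obtain ⟨M, ⟨hMn, hMF⟩, hmin⟩ := hK.exists_isMinOn ⟨A, le_rfl (a := ∑ i, ∑ j, A i j ^ 2), le_rfl (a := F A)⟩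
    hcont.continuousOn
  refine ⟨M, mem_conformalSet_of_forall_mulVec M fun u => ?_, hMF⟩
  by_contra! hu
  obtain ⟨N, hNF, hN⟩ := exists_apply_le_sum_sq_lt hrc hiso M u hu
  exact absurd (hmin ⟨hN.le.trans hMn, hNF.trans hMF⟩) (not_le.2 hN)

/-- For a continuous, rank-one convex, isotropic `F : ℝ^{n×n} → ℝ`, the
infimum of `F` over all matrices equals the infimum of `F` over `CO(n)`. -/
theorem stmt_5 {n : ℕ} (F : Matrix (Fin n) (Fin n) ℝ → ℝ)
    (hFc : Continuous F) (hrc : RankOneConvex F) (hiso : Isotropic F) :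
    sInf (Set.range F) = sInf (F '' ConformalSet n) := by
  have hlb : lowerBounds (Set.range F) = lowerBounds (F '' ConformalSet n) := by
    refine Subset.antisymm (lowerBounds_mono_set (image_subset_range F _)) ?_
    rintro m hm _ ⟨A, rfl⟩
    obtain ⟨M, hM, hMA⟩ := exists_mem_conformalSet_apply_le hFc hrc hiso A
    exact (hm (mem_image_of_mem F hM)).trans hMA
  have hsInf : ∀ s t : Set ℝ, s.Nonempty → t.Nonempty → lowerBounds s = lowerBounds t →
      sInf s = sInf t := fun s t hs ht h => by
    by_cases hb : BddBelow s
    · have ht' : IsGLB t (sInf s) := by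
        have := isGLB_csInf hs hb
        rwa [IsGLB, h] at this
      exact (ht'.csInf_eq ht).symm
    · have hb' : ¬ BddBelow t := by rwa [BddBelow, ← h]
      rw [Real.sInf_of_not_bddBelow hb, Real.sInf_of_not_bddBelow hb']
  exact hsInf _ _ (range_nonempty F)
    ⟨_, mem_image_of_mem F (⟨1, 1, by simp, rfl⟩ : (1 : ℝ) • 1 ∈ ConformalSet n)⟩ hlb
end

section
/- (Extremality of the Burkholder integrand) Let n ≥ 2 and p ≥ n/2. Let F : ℝ^{n×n} → ℝ be continuous, rank-one convex, positively p-homogeneous, and suppose there is a function f : ℝ² → ℝ such that F(A) = f(|A|ⁿ, det A) for all A ∈ ℝ^{n×n}. If either p ≤ n and F(Id) = B_p(Id), or p ≥ n and F(Īd) = B_p(Īd) where Īd = diag(1,…,1,−1), then F(A) ≥ B_p(A) for all A ∈ ℝ^{n×n}. -/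
open Matrix MeasureTheory Set

/-- The Burkholder integrand `B_p(A) = (|1 - n/p| |A|^n + det A) |A|^(p-n)`, with
`B_p(0) = 0`. -/
noncomputable def Burk (n : ℕ) (p : ℝ) (A : Matrix (Fin n) (Fin n) ℝ) : ℝ :=
  if A = 0 then 0
  else (|1 - (n : ℝ) / p| * opNorm A ^ (n : ℕ) + A.det) * opNorm A ^ (p - (n : ℝ))

lemma opNorm_diagonal {n : ℕ} (v : Fin n → ℝ) :
    opNorm (Matrix.diagonal v) = ‖v‖ :=
  Matrix.l2_opNorm_diagonal v

lemma opNorm_smul {n : ℕ} (t : ℝ) (A : Matrix (Fin n) (Fin n) ℝ) :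
    opNorm (t • A) = |t| * opNorm A := by
  simp [opNorm, norm_smul]

lemma opNorm_pos {n : ℕ} {A : Matrix (Fin n) (Fin n) ℝ} (hA : A ≠ 0) : 0 < opNorm A := by
  simpa [opNorm] using hA

/-- The absolute value of the determinant is at most the `n`-th power of the operator norm:
compare the volume of the unit ball with that of its image. -/
lemma abs_det_le_opNorm_pow {n : ℕ} (A : Matrix (Fin n) (Fin n) ℝ) :
    |A.det| ≤ opNorm A ^ n := by
  set L := LinearMap.toContinuousLinearMap (Matrix.toEuclideanLin A) with hL
  have hdet : LinearMap.det (L : EuclideanSpace ℝ (Fin n) →ₗ[ℝ] EuclideanSpace ℝ (Fin n))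
      = A.det := by
    rw [hL, LinearMap.coe_toContinuousLinearMap]
    exact LinearMap.det_toLin (PiLp.basisFun 2 ℝ (Fin n)) A
  have himg := Measure.addHaar_image_continuousLinearMap volume L (Metric.closedBall 0 1)
  have hsub : L '' Metric.closedBall 0 1 ⊆ Metric.closedBall 0 ‖L‖ := by
    rintro _ ⟨x, hx, rfl⟩
    rw [mem_closedBall_zero_iff] at hx ⊢
    exact L.le_of_opNorm_le_of_le le_rfl hx |>.trans (by simp)
  have hle := measure_mono (μ := volume) hsub
  rw [himg, hdet, Measure.addHaar_closedBall' volume 0 (norm_nonneg L),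
    finrank_euclideanSpace_fin] at hle
  have hpos : volume (Metric.closedBall (0 : EuclideanSpace ℝ (Fin n)) 1) ≠ 0 :=
    (Metric.measure_closedBall_pos volume 0 one_pos).ne'
  have hfin : volume (Metric.closedBall (0 : EuclideanSpace ℝ (Fin n)) 1) ≠ ⊤ :=
    measure_closedBall_lt_top.ne
  rw [ENNReal.mul_le_mul_iff_left hpos hfin] at hle
  exact (ENNReal.ofReal_le_ofReal_iff (pow_nonneg (norm_nonneg L) n)).1 hle

/-- The matrix `diag(1, …, 1, x)`. -/
noncomputable def lastDiagonal (n : ℕ) (x : ℝ) : Matrix (Fin n) (Fin n) ℝ :=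
  Matrix.diagonal (fun i => if (i : ℕ) = n - 1 then x else 1)

lemma lastDiagonal_one (n : ℕ) : lastDiagonal n 1 = 1 := by
  simp [lastDiagonal]

lemma det_lastDiagonal {n : ℕ} (hn : 1 ≤ n) (x : ℝ) : (lastDiagonal n x).det = x := by
  obtain ⟨m, rfl⟩ := Nat.exists_eq_add_of_le' hn
  rw [lastDiagonal, Matrix.det_diagonal, Fin.prod_univ_castSucc]
  simp [fun i : Fin m => i.2.ne]

lemma opNorm_lastDiagonal {n : ℕ} (hn : 2 ≤ n) (x : ℝ) :
    opNorm (lastDiagonal n x) = max 1 |x| := by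
  rw [lastDiagonal, opNorm_diagonal]
  apply le_antisymm
  · rw [pi_norm_le_iff_of_nonneg (by positivity)]
    intro i
    split_ifs <;> simp
  · apply max_le
    · have h := norm_le_pi_norm (fun i : Fin n => if (i : ℕ) = n - 1 then x else 1) ⟨0, by omega⟩
      have h0 : (0 : ℕ) ≠ n - 1 := by omega
      simpa [h0] using h
    · simpa using norm_le_pi_norm (fun i : Fin n => if (i : ℕ) = n - 1 then x else 1)
        ⟨n - 1, by omega⟩

lemma RankOneConvex.convexOn_lastDiagonal {n : ℕ} (hn : 1 ≤ n)
    {F : Matrix (Fin n) (Fin n) ℝ → ℝ} (hF : RankOneConvex F) :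
    ConvexOn ℝ univ (fun x => F (lastDiagonal n x)) := by
  set X : Matrix (Fin n) (Fin n) ℝ :=
    Matrix.diagonal (fun i => if (i : ℕ) = n - 1 then 1 else 0) with hX
  have hrank : X.rank = 1 := by
    rw [hX, Matrix.rank_diagonal, Fintype.card_eq_one_iff]
    refine ⟨⟨⟨n - 1, by omega⟩, by simp⟩, ?_⟩
    rintro ⟨i, hi⟩
    ext
    simpa using hi
  convert hF (lastDiagonal n 0) X hrank using 3 with x
  rw [hX, lastDiagonal, lastDiagonal, ← Matrix.diagonal_smul, Matrix.diagonal_add]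
  congr 1
  ext i
  by_cases h : (i : ℕ) = n - 1 <;> simp [h]

/-- If `F` depends only on `|A|ⁿ` and `det A` and is homogeneous, then it is determined by its
values on the segment `diag(1, …, 1, x)`, `|x| ≤ 1`. -/
lemma PosHomogeneous.eq_rpow_mul_lastDiagonal {n : ℕ} (hn : 2 ≤ n) {p : ℝ}
    {F : Matrix (Fin n) (Fin n) ℝ → ℝ} (hF : PosHomogeneous p F) {f : ℝ × ℝ → ℝ}
    (hrep : ∀ A : Matrix (Fin n) (Fin n) ℝ, F A = f (opNorm A ^ n, A.det))
    {A : Matrix (Fin n) (Fin n) ℝ} (hA : A ≠ 0) :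
    F A = opNorm A ^ p * F (lastDiagonal n (A.det / opNorm A ^ n)) := by
  have hr := opNorm_pos hA
  have hd : |A.det / opNorm A ^ n| ≤ 1 := by
    rw [abs_div, abs_of_pos (pow_pos hr n)]
    exact div_le_one_of_le₀ (abs_det_le_opNorm_pow A) (pow_pos hr n).le
  rw [← hF _ _ hr, hrep A, hrep (_ • _), opNorm_smul, opNorm_lastDiagonal hn, max_eq_left hd,
    Matrix.det_smul, det_lastDiagonal (by omega), abs_of_pos hr, mul_one, Fintype.card_fin,
    mul_div_cancel₀ _ (pow_pos hr n).ne']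

/-- A convex function on the line satisfying `φ x = x ^ p * φ (x ^ (1 - q))` for `x > 1` lies,
to the left of `1`, above the line through `(1, φ 1)` with slope `p / q * φ 1`. -/
lemma ConvexOn.mul_le_of_rpow_symm {φ : ℝ → ℝ} (hφ : ConvexOn ℝ univ φ) {p q : ℝ} (hq : 1 < q)
    (hsymm : ∀ x, 1 < x → φ x = x ^ p * φ (x ^ (1 - q))) {y : ℝ} (hy : y ≤ 1) :
    φ 1 * (1 + p / q * (y - 1)) ≤ φ y := by
  rcases hy.eq_or_lt with rfl | hy
  · simp
  have hy' : 0 < 1 - y := by linarith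
  set s := (φ 1 - φ y) / (1 - y) with hs
  have hφy : φ y = φ 1 - s * (1 - y) := by rw [hs]; field_simp; ring
  have hchord : ∀ z, y < z → z < 1 → φ z ≤ φ 1 - s * (1 - z) := by
    intro z hyz hz
    have h := hφ.slope_mono_adjacent (mem_univ y) (mem_univ 1) hyz hz
    rw [div_le_div_iff₀ (by linarith) (by linarith), hφy] at h
    nlinarith
  have houter : ∀ x, 1 < x → φ 1 + s * (x - 1) ≤ φ x := by
    intro x hx
    have h := hφ.slope_mono_adjacent (mem_univ y) (mem_univ x) hy hx
    rw [← hs, le_div_iff₀ (by linarith)] at h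
    linarith
  set h : ℝ → ℝ := fun x => x ^ p * (φ 1 - s * (1 - x ^ (1 - q))) - (φ 1 + s * (x - 1)) with hh
  have hh1 : h 1 = 0 := by simp [hh]
  have hd1 (a : ℝ) : HasDerivAt (fun x : ℝ => x ^ a) a 1 := by
    simpa using Real.hasDerivAt_rpow_const (x := 1) (p := a) (Or.inl one_ne_zero)
  have hderiv : HasDerivAt h (p * φ 1 - q * s) 1 := by
    have := ((hd1 p).mul ((((hd1 (1 - q)).const_sub 1).const_mul s).const_sub (φ 1))).sub
      ((((hasDerivAt_id (1 : ℝ)).sub_const 1).const_mul s).const_add (φ 1))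
    refine this.congr_deriv ?_
    simp
    ring
  have hlim := (hasDerivWithinAt_iff_tendsto_slope' self_notMem_Ioi).1
    (hderiv.hasDerivWithinAt (s := Ioi 1))
  have hnonneg : ∀ᶠ x in nhdsWithin (1 : ℝ) (Ioi 1), 0 ≤ slope h 1 x := by
    have hcont : Filter.Tendsto (fun x : ℝ => x ^ (1 - q)) (nhdsWithin 1 (Ioi 1)) (nhds 1) := by
      simpa using (hd1 (1 - q)).continuousAt.tendsto.mono_left nhdsWithin_le_nhds
    filter_upwards [hcont.eventually (lt_mem_nhds hy), self_mem_nhdsWithin] with x hx hx1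
    have hx1 : 1 < x := hx1
    have hlt : x ^ (1 - q) < 1 := Real.rpow_lt_one_of_one_lt_of_neg hx1 (by linarith)
    rw [slope_def_field, hh1, sub_zero]
    refine div_nonneg (sub_nonneg.2 ((houter x hx1).trans ?_)) (by linarith)
    rw [hsymm x hx1]
    gcongr
    exact hchord _ hx hlt
  have hle : 0 ≤ p * φ 1 - q * s := ge_of_tendsto hlim hnonneg
  have hs_le : s ≤ p / q * φ 1 := by
    rw [div_mul_eq_mul_div, le_div_iff₀ (by linarith)]
    linarith
  rw [hφy]
  nlinarith

/-- **Extremality of the Burkholder integrand.** Let `n ≥ 2`, `p ≥ n/2`,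
and let `F` be continuous, rank-one convex, positively `p`-homogeneous, with
`F(A) = f(|A|ⁿ, det A)` for some `f`. If either `p ≤ n` and `F(Id) = B_p(Id)`, or
`p ≥ n` and `F(Īd) = B_p(Īd)`, then `F ≥ B_p` everywhere. -/
theorem stmt_9 {n : ℕ} (hn : 2 ≤ n) (p : ℝ) (hp : (n : ℝ) / 2 ≤ p)
    (F : Matrix (Fin n) (Fin n) ℝ → ℝ)
    (hFc : Continuous F) (hrc : RankOneConvex F) (hhom : PosHomogeneous p F)
    (f : ℝ × ℝ → ℝ)
    (hrep : ∀ A : Matrix (Fin n) (Fin n) ℝ, F A = f (opNorm A ^ (n : ℕ), A.det))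
    (hcase : (p ≤ (n : ℝ) ∧ F 1 = Burk n p 1) ∨
             ((n : ℝ) ≤ p ∧ F (Ibar n) = Burk n p (Ibar n))) :
    ∀ A : Matrix (Fin n) (Fin n) ℝ, Burk n p A ≤ F A := by
  have hn' : (2 : ℝ) ≤ n := by exact_mod_cast hn
  have hp0 : 0 < p := by linarith
  have hn0 : (n : ℝ) ≠ 0 := by linarith
  have hconv := hrc.convexOn_lastDiagonal (by omega : 1 ≤ n)
  have hkey {A : Matrix (Fin n) (Fin n) ℝ} (hA : A ≠ 0) :=
    hhom.eq_rpow_mul_lastDiagonal hn hrep hA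
  have hne (x : ℝ) : lastDiagonal n x ≠ 0 := by
    intro h
    have := opNorm_lastDiagonal hn x
    rw [h] at this
    simp only [opNorm, map_zero, norm_zero] at this
    linarith [le_max_left 1 |x|]
  have hpow {x : ℝ} (hx : 1 < x) : x / x ^ n = x ^ (1 - (n : ℝ)) := by
    rw [Real.rpow_sub (by linarith), Real.rpow_one, Real.rpow_natCast]
  have hsymm : ∀ x : ℝ, 1 < x →
      F (lastDiagonal n x) = x ^ p * F (lastDiagonal n (x ^ (1 - (n : ℝ)))) := by
    intro x hx
    have h := hkey (hne x)
    rwa [det_lastDiagonal (by omega), opNorm_lastDiagonal hn,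
      abs_of_pos (by linarith), max_eq_right hx.le, hpow hx] at h
  have hsymm_neg : ∀ x : ℝ, 1 < x →
      F (lastDiagonal n (-x)) = x ^ p * F (lastDiagonal n (-x ^ (1 - (n : ℝ)))) := by
    intro x hx
    have h := hkey (hne (-x))
    rwa [det_lastDiagonal (by omega), opNorm_lastDiagonal hn, abs_neg,
      abs_of_pos (by linarith), max_eq_right hx.le, neg_div, hpow hx] at h
  have hBurk (x : ℝ) (hx : |x| = 1) :
      Burk n p (lastDiagonal n x) = |1 - (n : ℝ) / p| + x := by
    simp [Burk, hne, opNorm_lastDiagonal hn, hx, det_lastDiagonal (by omega : 1 ≤ n)]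
  have hsegment : ∀ d : ℝ, |d| ≤ 1 → |1 - (n : ℝ) / p| + d ≤ F (lastDiagonal n d) := by
    intro d hd
    rcases hcase with ⟨hpn, h1⟩ | ⟨hpn, h1⟩
    · rw [← lastDiagonal_one, hBurk 1 (by simp)] at h1
      have habs : |1 - (n : ℝ) / p| = n / p - 1 := by
        rw [abs_of_nonpos (by linarith [(one_le_div hp0).2 hpn])]
        ring
      have h := hconv.mul_le_of_rpow_symm (by linarith) hsymm (abs_le.1 hd).2
      simp only [h1, habs] at h
      refine le_of_eq_of_le ?_ h
      rw [habs]
      field_simp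
      ring
    · rw [show Ibar n = lastDiagonal n (-1) from rfl, hBurk (-1) (by simp)] at h1
      have habs : |1 - (n : ℝ) / p| = 1 - n / p :=
        abs_of_nonneg (by linarith [(div_le_one hp0).2 hpn])
      have hconv_neg : ConvexOn ℝ univ (fun x => F (lastDiagonal n (-x))) := by
        simpa [Function.comp_def] using hconv.comp_linearMap (-LinearMap.id)
      have h := hconv_neg.mul_le_of_rpow_symm (by linarith) hsymm_neg
        (y := -d) (by linarith [(abs_le.1 hd).1])
      simp only [h1, habs, neg_neg] at h
      refine le_of_eq_of_le ?_ h
      rw [habs]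
      field_simp
      ring
  intro A
  by_cases hA : A = 0
  · have h := hhom 0 2 two_pos
    rw [smul_zero] at h
    have h2 : (1 : ℝ) < 2 ^ p := Real.one_lt_rpow one_lt_two hp0
    have h0 : F 0 = 0 := by
      have : (2 ^ p - 1) * F 0 = 0 := by linarith
      exact (mul_eq_zero.1 this).resolve_left (by linarith)
    simp [hA, Burk, h0]
  · have hr := opNorm_pos hA
    have hrn := pow_pos hr n
    have hd : |A.det / opNorm A ^ n| ≤ 1 := by
      rw [abs_div, abs_of_pos hrn]
      exact div_le_one_of_le₀ (abs_det_le_opNorm_pow A) hrn.le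
    have hB : Burk n p A = opNorm A ^ p * (|1 - (n : ℝ) / p| + A.det / opNorm A ^ n) := by
      rw [Burk, if_neg hA, Real.rpow_sub hr, Real.rpow_natCast]
      field_simp
    rw [hB, hkey hA]
    gcongr
    exact hsegment _ hd
end

section
/- (B_p is quasiaffine along non-expanding radial stretchings) Let n ≥ 2 and let ρ : [0,1] → [0,1] be Lipschitz with ρ(0) = 0, ρ(1) = 1 and |ρ'(r)| ≤ ρ(r)/r for a.e. r ∈ (0,1). Define the radial stretching φ : 𝔹ⁿ → ℝⁿ by φ(x) = ρ(|x|) x/|x| for x ≠ 0 and φ(0) = 0, and its conjugate φ̄(x) = ρ(|x|) x̄/|x| where x̄ = (x₁,…,x_{n−1},−xₙ). Then: if n/2 ≤ p ≤ n, the average of B_p(Dφ) over the unit ball 𝔹ⁿ equals B_p(Id); and if p ≥ n, the average of B_p(Dφ̄) over 𝔹ⁿ equals B_p(Īd), where Īd = diag(1,…,1,−1) and Dφ denotes the a.e. derivative. -/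
open Matrix MeasureTheory Set

/-- The Euclidean norm on `Fin n → ℝ`. -/
noncomputable def eNorm {n : ℕ} (x : Fin n → ℝ) : ℝ := Real.sqrt (∑ i, x i ^ 2)

/-- The radial stretching `φ(x) = ρ(|x|) x/|x|`, `φ(0) = 0`. -/
noncomputable def radial {n : ℕ} (ρ : ℝ → ℝ) (x : Fin n → ℝ) : Fin n → ℝ :=
  if x = 0 then 0 else (ρ (eNorm x) / eNorm x) • x

/-- The conjugation `x̄ = (x₁, …, x_{n-1}, -xₙ)`. -/
noncomputable def conjMap {n : ℕ} (x : Fin n → ℝ) : Fin n → ℝ :=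
  fun i => if (i : ℕ) = n - 1 then -x i else x i

theorem sum_sq_eq_norm_sq {n : ℕ} (v : EuclideanSpace ℝ (Fin n)) :
    ∑ i, v i ^ 2 = ‖v‖ ^ 2 := by
  rw [EuclideanSpace.real_norm_sq_eq]

theorem eNorm_ofLp {n : ℕ} (v : EuclideanSpace ℝ (Fin n)) : eNorm v.ofLp = ‖v‖ := by
  rw [eNorm, sum_sq_eq_norm_sq, Real.sqrt_sq (norm_nonneg v)]

theorem opNorm_zero {n : ℕ} : opNorm (0 : Matrix (Fin n) (Fin n) ℝ) = 0 := by
  simp [opNorm]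

/-- A matrix that expands no vector by more than `g`, and some nonzero vector by exactly `g`,
has operator norm `g`. -/
theorem opNorm_eq_of_forall_le_of_exists_eq {n : ℕ} {A : Matrix (Fin n) (Fin n) ℝ} {g : ℝ}
    (hg : 0 ≤ g)
    (hle : ∀ v : Fin n → ℝ, ∑ i, (A *ᵥ v) i ^ 2 ≤ g ^ 2 * ∑ i, v i ^ 2)
    (heq : ∃ v : Fin n → ℝ, v ≠ 0 ∧ ∑ i, (A *ᵥ v) i ^ 2 = g ^ 2 * ∑ i, v i ^ 2) :
    opNorm A = g := by
  have happly (v : EuclideanSpace ℝ (Fin n)) :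
      ‖LinearMap.toContinuousLinearMap (Matrix.toEuclideanLin A) v‖ ^ 2
        = ∑ i, (A *ᵥ v.ofLp) i ^ 2 := by
    rw [← sum_sq_eq_norm_sq]
    simp [Matrix.toLpLin_apply]
  refine le_antisymm (ContinuousLinearMap.opNorm_le_bound _ hg fun v => ?_) ?_
  · refine le_of_sq_le_sq ?_ (by positivity)
    rw [happly, mul_pow, ← sum_sq_eq_norm_sq]
    exact hle _
  · obtain ⟨v, hv, hve⟩ := heq
    set w : EuclideanSpace ℝ (Fin n) := WithLp.toLp 2 v
    have hw : 0 < ‖w‖ := norm_pos_iff.2 (by simpa [w] using hv)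
    have h1 : ‖LinearMap.toContinuousLinearMap (Matrix.toEuclideanLin A) w‖ = g * ‖w‖ := by
      rw [← sq_eq_sq₀ (norm_nonneg _) (by positivity), happly, mul_pow, ← sum_sq_eq_norm_sq]
      exact hve
    have h2 := (LinearMap.toContinuousLinearMap (Matrix.toEuclideanLin A)).le_opNorm w
    rw [h1] at h2
    exact le_of_mul_le_mul_right h2 hw

theorem diagonal_mul_smul_one_add_mulVec {n : ℕ} (s x v : Fin n → ℝ) (g c : ℝ) (i : Fin n) :
    ((diagonal s * (g • 1 + c • vecMulVec x x)) *ᵥ v) i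
      = s i * (g * v i + c * (x ⬝ᵥ v) * x i) := by
  rw [← mulVec_mulVec, mulVec_diagonal, add_mulVec, smul_mulVec, smul_mulVec, one_mulVec,
    vecMulVec_mulVec]
  simp only [Pi.add_apply, Pi.smul_apply, smul_eq_mul, MulOpposite.smul_eq_mul_unop,
    MulOpposite.unop_op]
  ring

theorem opNorm_diagonal_mul_smul_one_add {n : ℕ} (hn : 2 ≤ n) {s x : Fin n → ℝ} {g c : ℝ}
    (hs : ∀ i, s i ^ 2 = 1) (hg : 0 ≤ g) (hc : 2 * g * c + c ^ 2 * (x ⬝ᵥ x) ≤ 0) :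
    opNorm (diagonal s * (g • 1 + c • vecMulVec x x)) = g := by
  have hsum (v : Fin n → ℝ) :
      ∑ i, ((diagonal s * (g • 1 + c • vecMulVec x x)) *ᵥ v) i ^ 2
        = g ^ 2 * ∑ i, v i ^ 2 + (x ⬝ᵥ v) ^ 2 * (2 * g * c + c ^ 2 * (x ⬝ᵥ x)) := by
    simp only [diagonal_mul_smul_one_add_mulVec, mul_pow, hs, one_mul]
    generalize ht : x ⬝ᵥ v = t
    have : ∀ i, (g * v i + c * t * x i) ^ 2
        = g ^ 2 * v i ^ 2 + 2 * g * c * t * (x i * v i) + c ^ 2 * t ^ 2 * (x i * x i) :=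
      fun i => by ring
    simp only [this, Finset.sum_add_distrib, ← Finset.mul_sum]
    rw [← ht]
    simp only [dotProduct]
    ring
  refine opNorm_eq_of_forall_le_of_exists_eq hg (fun v => ?_) ?_
  · rw [hsum]
    nlinarith [mul_nonneg (sq_nonneg (x ⬝ᵥ v)) (neg_nonneg.2 hc)]
  · have : Nontrivial (Fin n) := Fin.nontrivial_iff_two_le.2 hn
    obtain ⟨v, hv, hxv⟩ := exists_ne_zero_dotProduct_eq_zero x
    exact ⟨v, hv, by rw [hsum, dotProduct_comm, hxv]; ring⟩

theorem det_diagonal_mul_smul_one_add {n : ℕ} (hn : 1 ≤ n) (s x : Fin n → ℝ) {g : ℝ} (c : ℝ)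
    (hg : g ≠ 0) :
    (diagonal s * (g • 1 + c • vecMulVec x x)).det
      = (∏ i, s i) * (g ^ (n - 1) * (g + c * (x ⬝ᵥ x))) := by
  have h : g • (1 : Matrix (Fin n) (Fin n) ℝ) + c • vecMulVec x x
      = g • (1 + replicateCol Unit ((c / g) • x) * replicateRow Unit x) := by
    rw [← vecMulVec_eq, smul_vecMulVec, smul_add, smul_smul, mul_div_cancel₀ _ hg]
  rw [det_mul, det_diagonal, h, det_smul, det_one_add_replicateCol_mul_replicateRow,
    dotProduct_smul, Fintype.card_fin, smul_eq_mul]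
  obtain ⟨m, rfl⟩ : ∃ m, n = m + 1 := ⟨n - 1, by omega⟩
  simp only [Nat.add_sub_cancel]
  field_simp
  ring

theorem burk_diagonal_mul_smul_one_add {n : ℕ} (hn : 2 ≤ n) {p : ℝ} (hp : p ≠ 0)
    {s x : Fin n → ℝ} {g c d : ℝ} (hs : ∀ i, s i ^ 2 = 1)
    (hsign : |1 - (n : ℝ) / p| = (∏ i, s i) * ((n : ℝ) / p - 1))
    (hd : |d| ≤ g) (hcd : c * (x ⬝ᵥ x) = d - g) (hx : 0 < x ⬝ᵥ x) :
    Burk n p (diagonal s * (g • 1 + c • vecMulVec x x))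
      = (∏ i, s i) * (((n : ℝ) / p - 1) * g ^ p + d * g ^ (p - 1)) := by
  have hg : 0 ≤ g := (abs_nonneg d).trans hd
  have hc : 2 * g * c + c ^ 2 * (x ⬝ᵥ x) ≤ 0 := by
    have h1 : (2 * g * c + c ^ 2 * (x ⬝ᵥ x)) * (x ⬝ᵥ x) = d ^ 2 - g ^ 2 := by
      linear_combination (2 * g + c * (x ⬝ᵥ x) + d - g) * hcd
    have h2 : d ^ 2 ≤ g ^ 2 := sq_le_sq' (neg_le_of_abs_le hd) (le_of_abs_le hd)
    by_contra! h
    nlinarith [mul_pos h hx]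
  have hop := opNorm_diagonal_mul_smul_one_add hn hs hg hc
  rcases hg.eq_or_lt with rfl | hg
  · have hd0 : d = 0 := abs_eq_zero.1 (le_antisymm hd (abs_nonneg d))
    have hc0 : c = 0 := by
      rw [hd0, sub_zero] at hcd
      exact (mul_eq_zero.1 hcd).resolve_right hx.ne'
    simp [Burk, hd0, hc0, Real.zero_rpow hp]
  · have hA : diagonal s * (g • 1 + c • vecMulVec x x) ≠ 0 := by
      intro h
      rw [h, opNorm_zero] at hop
      exact hg.ne hop
    rw [Burk, if_neg hA, hop, det_diagonal_mul_smul_one_add (by omega) s x c hg.ne', hcd, hsign,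
      Real.rpow_sub hg, Real.rpow_sub hg, Real.rpow_natCast, Real.rpow_one]
    obtain ⟨m, rfl⟩ : ∃ m, n = m + 1 := ⟨n - 1, by omega⟩
    simp only [Nat.add_sub_cancel]
    field_simp
    ring

theorem burk_diagonal {n : ℕ} (hn : 2 ≤ n) {p : ℝ} (hp : p ≠ 0) {s : Fin n → ℝ}
    (hs : ∀ i, s i ^ 2 = 1)
    (hsign : |1 - (n : ℝ) / p| = (∏ i, s i) * ((n : ℝ) / p - 1)) :
    Burk n p (diagonal s) = (∏ i, s i) * ((n : ℝ) / p) := by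
  have h := burk_diagonal_mul_smul_one_add hn hp (x := 1) (g := 1) (c := 0) (d := 1) hs hsign
    (by simp) (by simp) (by simp; omega)
  simpa using h

/-- The fundamental theorem of calculus on `[0, 1]` for a function that is absolutely continuous
away from `0`, continuous at `0` and has bounded derivative. -/
theorem integral_deriv_eq_sub_of_bounded {H : ℝ → ℝ} {C : ℝ}
    (hac : ∀ ε ∈ Ioo (0 : ℝ) 1, AbsolutelyContinuousOnInterval H ε 1)
    (hlim : Filter.Tendsto H (nhdsWithin 0 (Ioi 0)) (nhds (H 0)))
    (hbd : ∀ᵐ r : ℝ, r ∈ Ioo (0 : ℝ) 1 → |deriv H r| ≤ C) :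
    ∫ r in Ioo (0 : ℝ) 1, deriv H r = H 1 - H 0 := by
  have hint : IntegrableOn (deriv H) (Ioo 0 1) :=
    Measure.integrableOn_of_bounded (M := C) (by simp)
      (measurable_deriv H).aestronglyMeasurable
      ((ae_restrict_iff' measurableSet_Ioo).2 (by simpa using hbd))
  have hint' : IntegrableOn (deriv H) (uIcc 0 1) := by
    rwa [uIcc_of_le zero_le_one, integrableOn_Icc_iff_integrableOn_Ioo]
  rw [← integral_Ioc_eq_integral_Ioo, ← intervalIntegral.integral_of_le zero_le_one]
  have hcont : Filter.Tendsto (fun ε => ∫ r in ε..1, deriv H r) (nhdsWithin 0 (Ioi 0))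
      (nhds (∫ r in (0 : ℝ)..1, deriv H r)) := by
    have h := intervalIntegral.continuousOn_primitive_interval_left hint' 0 left_mem_uIcc
    rw [uIcc_of_le zero_le_one] at h
    exact h.tendsto.mono_left
      ((nhdsWithin_Ioo_eq_nhdsGT (zero_lt_one' ℝ)).symm.le.trans
        (nhdsWithin_mono _ Ioo_subset_Icc_self))
  refine tendsto_nhds_unique hcont ((tendsto_const_nhds.sub hlim).congr' ?_)
  filter_upwards [Ioo_mem_nhdsGT (zero_lt_one' ℝ)] with ε hε
  exact (hac ε hε).integral_deriv_eq_sub.symm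

section Profile

variable {ρ : ℝ → ℝ} {K : NNReal} {p a : ℝ}

theorem le_mul_of_lipschitzOnWith (hlip : LipschitzOnWith K ρ (Icc 0 1)) (h0 : ρ 0 = 0) {r : ℝ}
    (hr : r ∈ Icc (0 : ℝ) 1) : ρ r ≤ K * r := by
  have h := hlip.dist_le_mul r hr 0 (by simp)
  rw [h0, dist_zero_right, dist_zero_right, Real.norm_eq_abs, Real.norm_eq_abs,
    abs_of_nonneg hr.1] at h
  exact (le_abs_self _).trans h

theorem absolutelyContinuousOnInterval_rpow_mul_rpow (hlip : LipschitzOnWith K ρ (Icc 0 1))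
    (hmap : ∀ r ∈ Icc (0 : ℝ) 1, ρ r ∈ Icc (0 : ℝ) 1) (hp : 1 ≤ p) {ε : ℝ}
    (hε : ε ∈ Ioo (0 : ℝ) 1) :
    AbsolutelyContinuousOnInterval (fun r => ρ r ^ p * r ^ a) ε 1 := by
  have hsub : uIcc ε 1 ⊆ Icc 0 1 := by
    rw [uIcc_of_le hε.2.le]
    exact Icc_subset_Icc_left hε.1.le
  obtain ⟨L, hL⟩ := ((Real.contDiff_rpow_const_of_le (n := 1) (by simpa using hp)).contDiffOn
    (s := Icc (0 : ℝ) 1)).locallyLipschitzOn (convex_Icc 0 1)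
    |>.exists_lipschitzOnWith_of_compact isCompact_Icc
  have h1 : AbsolutelyContinuousOnInterval (fun r => ρ r ^ p) ε 1 :=
    ((hL.comp hlip hmap).mono hsub).absolutelyContinuousOnInterval
  have h2 : AbsolutelyContinuousOnInterval (fun r : ℝ => r ^ a) ε 1 := by
    refine ContDiffOn.absolutelyContinuousOnInterval fun r hr => ?_
    rw [uIcc_of_le hε.2.le] at hr
    exact (Real.contDiffAt_rpow_const_of_ne (hε.1.trans_le hr.1).ne').contDiffWithinAt
  exact h1.fun_mul h2

theorem ae_differentiableAt_and_abs_deriv_le (hlip : LipschitzOnWith K ρ (Icc 0 1))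
    (hne : ∀ᵐ r ∂(volume.restrict (Ioo (0 : ℝ) 1)), |deriv ρ r| ≤ ρ r / r) :
    ∀ᵐ r : ℝ, r ∈ Ioo (0 : ℝ) 1 → DifferentiableAt ℝ ρ r ∧ |deriv ρ r| ≤ ρ r / r := by
  have hac : AbsolutelyContinuousOnInterval ρ 0 1 :=
    LipschitzOnWith.absolutelyContinuousOnInterval (by rwa [uIcc_of_le zero_le_one])
  rw [ae_restrict_iff' measurableSet_Ioo] at hne
  filter_upwards [hac.ae_differentiableAt, hne] with r hr1 hr2 hr
  exact ⟨hr1 (by rw [uIcc_of_le zero_le_one]; exact Ioo_subset_Icc_self hr), hr2 hr⟩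

theorem deriv_rpow_mul_rpow_sub {n : ℕ} (hn : 1 ≤ n) (hp : 1 ≤ p) {r : ℝ} (hr : 0 < r)
    (hρ : 0 ≤ ρ r) (hdiff : DifferentiableAt ℝ ρ r) :
    deriv (fun r => ρ r ^ p * r ^ ((n : ℝ) - p)) r
      = p * (r ^ (n - 1) * (((n : ℝ) / p - 1) * (ρ r / r) ^ p
          + deriv ρ r * (ρ r / r) ^ (p - 1))) := by
  have hp0 : p ≠ 0 := by positivity
  have h := (hdiff.hasDerivAt.rpow_const (p := p) (Or.inr hp)).fun_mul
    (Real.hasDerivAt_rpow_const (x := r) (p := (n : ℝ) - p) (Or.inl hr.ne'))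
  rw [h.deriv, Real.div_rpow hρ hr.le, Real.div_rpow hρ hr.le, Real.rpow_sub hr, Real.rpow_sub hr,
    Real.rpow_sub hr, Real.rpow_sub hr, Real.rpow_natCast, Real.rpow_one]
  obtain ⟨m, rfl⟩ : ∃ m, n = m + 1 := ⟨n - 1, by omega⟩
  have hrp : r ^ p ≠ 0 := (Real.rpow_pos_of_pos hr p).ne'
  simp only [Nat.add_sub_cancel]
  field_simp
  ring

/-- The radial integral of the Burkholder energy density of a non-expanding radial stretching. -/
theorem integral_profile {n : ℕ} (hn : 1 ≤ n) (hp : 1 ≤ p)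
    (hlip : LipschitzOnWith K ρ (Icc 0 1)) (hmap : ∀ r ∈ Icc (0 : ℝ) 1, ρ r ∈ Icc (0 : ℝ) 1)
    (h0 : ρ 0 = 0) (h1 : ρ 1 = 1)
    (hne : ∀ᵐ r ∂(volume.restrict (Ioo (0 : ℝ) 1)), |deriv ρ r| ≤ ρ r / r) :
    ∫ r in Ioo (0 : ℝ) 1, r ^ (n - 1) * (((n : ℝ) / p - 1) * (ρ r / r) ^ p
          + deriv ρ r * (ρ r / r) ^ (p - 1)) = 1 / p := by
  have hp0 : 0 < p := by positivity
  have hae := ae_differentiableAt_and_abs_deriv_le hlip hne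
  have hderiv : ∀ᵐ r : ℝ, r ∈ Ioo (0 : ℝ) 1 →
      deriv (fun r => ρ r ^ p * r ^ ((n : ℝ) - p)) r
      = p * (r ^ (n - 1) * (((n : ℝ) / p - 1) * (ρ r / r) ^ p
          + deriv ρ r * (ρ r / r) ^ (p - 1))) := by
    filter_upwards [hae] with r hr hr01
    exact deriv_rpow_mul_rpow_sub hn hp hr01.1 (hmap r (Ioo_subset_Icc_self hr01)).1 (hr hr01).1
  have hFTC := integral_deriv_eq_sub_of_bounded
    (H := fun r => ρ r ^ p * r ^ ((n : ℝ) - p))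
    (C := p * (|(n : ℝ) / p - 1| * (K : ℝ) ^ p + K * (K : ℝ) ^ (p - 1)))
    (fun ε hε => absolutelyContinuousOnInterval_rpow_mul_rpow hlip hmap hp hε) ?_ ?_
  · rw [setIntegral_congr_ae measurableSet_Ioo hderiv, integral_const_mul] at hFTC
    simp only [h0, h1, Real.one_rpow, Real.zero_rpow hp0.ne', zero_mul, mul_one, sub_zero] at hFTC
    rw [eq_div_iff hp0.ne', mul_comm, hFTC]
  · simp only [h0, Real.zero_rpow hp0.ne', zero_mul]
    refine squeeze_zero' (g := fun r => (K : ℝ) ^ p * r ^ n) ?_ ?_ ?_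
    · filter_upwards [Ioo_mem_nhdsGT (zero_lt_one' ℝ)] with r hr
      have := (hmap r (Ioo_subset_Icc_self hr)).1
      have := hr.1
      positivity
    · filter_upwards [Ioo_mem_nhdsGT (zero_lt_one' ℝ)] with r hr
      have hr0 := hr.1
      calc ρ r ^ p * r ^ ((n : ℝ) - p) ≤ (K * r) ^ p * r ^ ((n : ℝ) - p) := by
            have := (hmap r (Ioo_subset_Icc_self hr)).1
            have := le_mul_of_lipschitzOnWith hlip h0 (Ioo_subset_Icc_self hr)
            gcongr
        _ = (K : ℝ) ^ p * r ^ n := by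
            rw [Real.mul_rpow K.coe_nonneg hr0.le, mul_assoc, ← Real.rpow_add hr0, add_sub_cancel,
              Real.rpow_natCast]
    · have : Filter.Tendsto (fun r : ℝ => (K : ℝ) ^ p * r ^ n) (nhds 0)
          (nhds ((K : ℝ) ^ p * 0 ^ n)) := Continuous.tendsto (by fun_prop) 0
      rw [zero_pow (by omega), mul_zero] at this
      exact this.mono_left nhdsWithin_le_nhds
  · filter_upwards [hae, hderiv] with r hr hd hr01
    rw [hd hr01]
    have hr0 := hr01.1
    have hρ := (hmap r (Ioo_subset_Icc_self hr01)).1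
    have hg0 : 0 ≤ ρ r / r := by positivity
    have hgK : ρ r / r ≤ K := by
      rw [div_le_iff₀ hr0]
      exact le_mul_of_lipschitzOnWith hlip h0 (Ioo_subset_Icc_self hr01)
    have hdK : |deriv ρ r| ≤ K := (hr hr01).2.trans hgK
    have hrn : |r ^ (n - 1)| ≤ 1 := by
      rw [abs_of_pos (by positivity)]
      exact pow_le_one₀ hr0.le hr01.2.le
    have hp1 : 0 ≤ p - 1 := sub_nonneg.2 hp
    rw [abs_mul, abs_of_pos hp0, abs_mul]
    refine mul_le_mul_of_nonneg_left ?_ hp0.le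
    refine (mul_le_of_le_one_left (abs_nonneg _) hrn).trans ((abs_add_le _ _).trans ?_)
    rw [abs_mul, abs_mul, abs_of_nonneg (Real.rpow_nonneg hg0 p),
      abs_of_nonneg (Real.rpow_nonneg hg0 (p - 1))]
    gcongr

end Profile

theorem eNorm_sq {n : ℕ} (x : Fin n → ℝ) : eNorm x ^ 2 = x ⬝ᵥ x := by
  rw [eNorm, Real.sq_sqrt (Finset.sum_nonneg fun i _ => sq_nonneg _)]
  simp [dotProduct, sq]

theorem hasFDerivAt_eNorm {n : ℕ} {x : Fin n → ℝ} (hx : 0 < eNorm x) :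
    HasFDerivAt eNorm
      (∑ i, (x i / eNorm x) • (ContinuousLinearMap.proj i : (Fin n → ℝ) →L[ℝ] ℝ)) x := by
  have hsum : HasFDerivAt (fun y : Fin n → ℝ => ∑ i, y i ^ 2)
      (∑ i, (2 * x i) • (ContinuousLinearMap.proj i : (Fin n → ℝ) →L[ℝ] ℝ)) x := by
    refine HasFDerivAt.fun_sum fun i _ => ?_
    simpa using (hasFDerivAt_apply (𝕜 := ℝ) i x).pow 2
  have h := hsum.sqrt (Real.sqrt_pos.1 hx).ne'
  refine h.congr_fderiv ?_
  rw [Finset.smul_sum]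
  refine Finset.sum_congr rfl fun i _ => ?_
  rw [smul_smul]
  congr 1
  change 1 / (2 * eNorm x) * (2 * x i) = x i / eNorm x
  field_simp

/-- The derivative of a radial stretching, with the signs of the coordinates of the target
possibly changed. -/
theorem gradMat_mul_radial {n : ℕ} {ρ : ℝ → ℝ} (s : Fin n → ℝ) {x : Fin n → ℝ}
    (hx : 0 < eNorm x) (hρ : DifferentiableAt ℝ ρ (eNorm x)) :
    gradMat (fun y => s * radial ρ y) x
      = diagonal s * ((ρ (eNorm x) / eNorm x) • 1
        + ((deriv ρ (eNorm x) - ρ (eNorm x) / eNorm x) / eNorm x ^ 2) • vecMulVec x x) := by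
  have hx0 : x ≠ 0 := by
    rintro rfl
    simp [eNorm] at hx
  have hq : HasDerivAt (fun r => ρ r / r)
      ((deriv ρ (eNorm x) - ρ (eNorm x) / eNorm x) / eNorm x) (eNorm x) := by
    refine (hρ.hasDerivAt.fun_div (hasDerivAt_id (eNorm x)) hx.ne').congr_deriv ?_
    simp only [id]
    field_simp
  have hq' := hq.comp_hasFDerivAt x (hasFDerivAt_eNorm hx)
  have hloc : (fun y => s * radial ρ y)
      =ᶠ[nhds x] fun y i => s i * (ρ (eNorm y) / eNorm y * y i) := by
    filter_upwards [isOpen_ne.mem_nhds hx0] with y hy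
    ext i
    simp [radial, if_neg hy]
  have hcoord (i : Fin n) := (hq'.mul (hasFDerivAt_apply (𝕜 := ℝ) i x)).const_mul (s i)
  have h := (hasFDerivAt_pi.2 hcoord).congr_of_eventuallyEq hloc
  ext i j
  rw [gradMat, of_apply, h.fderiv]
  simp [Matrix.diagonal_mul, Matrix.one_apply, Pi.single_apply, vecMulVec_apply]
  split_ifs
  · field_simp
  · field_simp
    ring

theorem burk_gradMat_mul_radial {n : ℕ} (hn : 2 ≤ n) {p : ℝ} (hp : p ≠ 0) {ρ : ℝ → ℝ}
    {s x : Fin n → ℝ} (hs : ∀ i, s i ^ 2 = 1)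
    (hsign : |1 - (n : ℝ) / p| = (∏ i, s i) * ((n : ℝ) / p - 1)) (hx : 0 < eNorm x)
    (hρ : DifferentiableAt ℝ ρ (eNorm x))
    (hd : |deriv ρ (eNorm x)| ≤ ρ (eNorm x) / eNorm x) :
    Burk n p (gradMat (fun y => s * radial ρ y) x)
      = (∏ i, s i) * (((n : ℝ) / p - 1) * (ρ (eNorm x) / eNorm x) ^ p
        + deriv ρ (eNorm x) * (ρ (eNorm x) / eNorm x) ^ (p - 1)) := by
  rw [gradMat_mul_radial s hx hρ]
  refine burk_diagonal_mul_smul_one_add hn hp hs hsign hd ?_ ?_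
  · rw [← eNorm_sq, div_mul_cancel₀ _ (by positivity)]
  · rw [← eNorm_sq]
    positivity

/-- A property of almost every real number holds for the norm of almost every vector. -/
theorem ae_norm_of_ae {E : Type*} [NormedAddCommGroup E] [NormedSpace ℝ E]
    [FiniteDimensional ℝ E] [Nontrivial E] [MeasurableSpace E] [BorelSpace E] (μ : Measure E)
    [μ.IsAddHaarMeasure] {P : ℝ → Prop} (hP : ∀ᵐ r : ℝ, P r) : ∀ᵐ x ∂μ, P ‖x‖ := by
  obtain ⟨t, ht, htm, ht0⟩ := exists_measurable_superset_of_null (ae_iff.1 hP)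
  have hzero : (fun y : ℝ => y ^ (Module.finrank ℝ E - 1) • t.indicator (1 : ℝ → ℝ) y)
      =ᵐ[volume.restrict (Ioi 0)] 0 := by
    have : ∀ᵐ y : ℝ, y ∉ t := measure_eq_zero_iff_ae_notMem.1 ht0
    filter_upwards [ae_restrict_of_ae this] with y hy
    simp [hy]
  have hint : Integrable (fun x : E => t.indicator (1 : ℝ → ℝ) ‖x‖) μ := by
    rw [integrable_fun_norm_addHaar]
    exact (integrable_zero _ _ _).congr hzero.symm
  have hI : ∫ x, t.indicator (1 : ℝ → ℝ) ‖x‖ ∂μ = 0 := by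
    rw [integral_fun_norm_addHaar, integral_congr_ae hzero]
    simp
  have hnonneg (x : E) : 0 ≤ t.indicator (1 : ℝ → ℝ) ‖x‖ :=
    indicator_nonneg (fun _ _ => zero_le_one) _
  rw [integral_eq_zero_iff_of_nonneg hnonneg hint] at hI
  filter_upwards [hI] with x hx
  by_contra hPx
  simp [indicator_of_mem (ht hPx)] at hx

theorem average_radial_eNorm {n : ℕ} (hn : 1 ≤ n) (F : (Fin n → ℝ) → ℝ) (f : ℝ → ℝ)
    (hF : ∀ᵐ r : ℝ, r ∈ Ioo (0 : ℝ) 1 → ∀ x : Fin n → ℝ, eNorm x = r → F x = f r) :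
    ⨍ x in {x : Fin n → ℝ | eNorm x < 1}, F x
      = n * ∫ r in Ioo (0 : ℝ) 1, r ^ (n - 1) * f r := by
  have : Nonempty (Fin n) := ⟨⟨0, hn⟩⟩
  have hpre : WithLp.ofLp ⁻¹' {x : Fin n → ℝ | eNorm x < 1}
      = Metric.ball (0 : EuclideanSpace ℝ (Fin n)) 1 := by
    ext v
    simp [eNorm_ofLp]
  have hmp := PiLp.volume_preserving_ofLp (Fin n)
  have hemb : MeasurableEmbedding (WithLp.ofLp : EuclideanSpace ℝ (Fin n) → Fin n → ℝ) :=
    (MeasurableEquiv.toLp 2 (Fin n → ℝ)).symm.measurableEmbedding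
  have hvol : volume.real {x : Fin n → ℝ | eNorm x < 1}
      = volume.real (Metric.ball (0 : EuclideanSpace ℝ (Fin n)) 1) := by
    rw [Measure.real, Measure.real, ← hpre, hmp.measure_preimage_emb hemb]
  have hpos : 0 < volume.real (Metric.ball (0 : EuclideanSpace ℝ (Fin n)) 1) :=
    ENNReal.toReal_pos (Metric.measure_ball_pos _ _ one_pos).ne' measure_ball_lt_top.ne
  have hball : ∫ v in Metric.ball (0 : EuclideanSpace ℝ (Fin n)) 1, F v.ofLp
      = ∫ v : EuclideanSpace ℝ (Fin n), (Iio 1).indicator f ‖v‖ := by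
    rw [← integral_indicator Metric.isOpen_ball.measurableSet]
    refine integral_congr_ae ?_
    filter_upwards [ae_norm_of_ae volume hF, Measure.ae_ne volume 0] with v hv hv0
    by_cases h1 : ‖v‖ < 1
    · rw [indicator_of_mem (by simpa using h1), indicator_of_mem (by exact h1)]
      exact hv ⟨norm_pos_iff.2 hv0, h1⟩ _ (eNorm_ofLp v)
    · rw [indicator_of_notMem (by simpa using h1), indicator_of_notMem (by exact h1)]
  have hIoo : ∫ y in Ioi (0 : ℝ), y ^ (n - 1) * (Iio 1).indicator f y
      = ∫ r in Ioo (0 : ℝ) 1, r ^ (n - 1) * f r := by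
    have : ∀ y : ℝ, y ^ (n - 1) * (Iio 1).indicator f y
        = (Iio 1).indicator (fun y => y ^ (n - 1) * f y) y := fun y => by
      by_cases hy : y ∈ Iio (1 : ℝ) <;> simp [hy]
    simp only [this]
    rw [setIntegral_indicator measurableSet_Iio, Ioi_inter_Iio]
  rw [setAverage_eq, ← hmp.setIntegral_preimage_emb hemb, hpre, hball, hvol,
    integral_fun_norm_addHaar, finrank_euclideanSpace_fin]
  simp only [smul_eq_mul, nsmul_eq_mul, hIoo]
  field_simp

/-- The Burkholder energy of a non-expanding radial stretching, with the signs of the coordinates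
of the target possibly changed. -/
theorem average_burk_gradMat_mul_radial {n : ℕ} (hn : 2 ≤ n) {p : ℝ} (hp : 1 ≤ p) {ρ : ℝ → ℝ}
    {K : NNReal} (hlip : LipschitzOnWith K ρ (Icc 0 1))
    (hmap : ∀ r ∈ Icc (0 : ℝ) 1, ρ r ∈ Icc (0 : ℝ) 1) (h0 : ρ 0 = 0) (h1 : ρ 1 = 1)
    (hne : ∀ᵐ r ∂(volume.restrict (Ioo (0 : ℝ) 1)), |deriv ρ r| ≤ ρ r / r)
    {s : Fin n → ℝ} (hs : ∀ i, s i ^ 2 = 1)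
    (hsign : |1 - (n : ℝ) / p| = (∏ i, s i) * ((n : ℝ) / p - 1)) :
    ⨍ x in {x : Fin n → ℝ | eNorm x < 1}, Burk n p (gradMat (fun y => s * radial ρ y) x)
      = Burk n p (diagonal s) := by
  have hp0 : p ≠ 0 := by positivity
  rw [burk_diagonal hn hp0 hs hsign, average_radial_eNorm (by omega) _
    (fun r => (∏ i, s i) * (((n : ℝ) / p - 1) * (ρ r / r) ^ p
      + deriv ρ r * (ρ r / r) ^ (p - 1)))]
  · simp only [mul_left_comm _ (∏ i, s i)]
    rw [integral_const_mul, integral_profile (by omega) hp hlip hmap h0 h1 hne]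
    ring
  · filter_upwards [ae_differentiableAt_and_abs_deriv_le hlip hne] with r hr hr01 x hx
    subst hx
    exact burk_gradMat_mul_radial hn hp0 hs hsign hr01.1 (hr hr01).1 (hr hr01).2

/-- `B_p` is quasiaffine along non-expanding radial stretchings: if
`ρ : [0,1] → [0,1]` is Lipschitz with `ρ(0) = 0`, `ρ(1) = 1` and `|ρ'(r)| ≤ ρ(r)/r` a.e.
on `(0,1)`, with `φ` the associated radial stretching and `φ̄` its conjugate, then the
average of `B_p(Dφ)` over the unit ball is `B_p(Id)` when `n/2 ≤ p ≤ n`, and the average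
of `B_p(Dφ̄)` is `B_p(Īd)` when `p ≥ n`. -/
theorem stmt_10 {n : ℕ} (hn : 2 ≤ n) (p : ℝ) (ρ : ℝ → ℝ) (K : NNReal)
    (hlip : LipschitzOnWith K ρ (Set.Icc 0 1))
    (hmap : ∀ r ∈ Set.Icc (0 : ℝ) 1, ρ r ∈ Set.Icc (0 : ℝ) 1)
    (h0 : ρ 0 = 0) (h1 : ρ 1 = 1)
    (hne : ∀ᵐ r ∂(volume.restrict (Set.Ioo (0 : ℝ) 1)), |deriv ρ r| ≤ ρ r / r) :
    ((n : ℝ) / 2 ≤ p → p ≤ (n : ℝ) →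
      (⨍ x in {x : Fin n → ℝ | eNorm x < 1}, Burk n p (gradMat (radial ρ) x)) =
        Burk n p 1) ∧
    ((n : ℝ) ≤ p →
      (⨍ x in {x : Fin n → ℝ | eNorm x < 1},
          Burk n p (gradMat (fun y => conjMap (radial ρ y)) x)) = Burk n p (Ibar n)) := by
  have hn1 : (2 : ℝ) ≤ n := by exact_mod_cast hn
  refine ⟨fun hp1 hp2 => ?_, fun hp => ?_⟩
  · have hp : 1 ≤ p := by linarith
    have hnp : 1 ≤ (n : ℝ) / p := (one_le_div (by linarith)).2 hp2
    have h := average_burk_gradMat_mul_radial hn hp hlip hmap h0 h1 hne (s := 1) (by simp)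
      (by rw [abs_of_nonpos (by linarith)]; simp)
    simpa using h
  · have hp1 : 1 ≤ p := by linarith
    have hnp : (n : ℝ) / p ≤ 1 := (div_le_one (by linarith)).2 hp
    have hprod : ∏ i : Fin n, (if (i : ℕ) = n - 1 then (-1 : ℝ) else 1) = -1 := by
      obtain ⟨m, rfl⟩ : ∃ m, n = m + 1 := ⟨n - 1, by omega⟩
      rw [Fin.prod_univ_castSucc]
      simp [Fin.val_castSucc, (Fin.is_lt _).ne]
    have h := average_burk_gradMat_mul_radial hn hp1 hlip hmap h0 h1 hne
      (s := fun i => if (i : ℕ) = n - 1 then -1 else 1) (fun i => by split_ifs <;> norm_num)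
      (by rw [hprod, abs_of_nonneg (by linarith)]; ring)
    have hconj : (fun y => conjMap (radial ρ y))
        = fun y => (fun i : Fin n => if (i : ℕ) = n - 1 then (-1 : ℝ) else 1) * radial ρ y := by
      ext y i
      simp [conjMap]
    rw [hconj]
    exact h
end
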